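/- arXiv:2407.14113 — 4 statements merged into one kernel-verified Lean document; each statement's English description precedes it below -/
import Mathlib

section
/- For every integer n ≥ 2 with n ≠ 4, the path P_n has local antimagic total chromatic number 2, while χ_lat(P_4) = 3. -/
open Finset

variable {V : Type*} [Fintype V] [DecidableEq V]

/-- The weight of a vertex `u` under the total labeling given by vertex labels `fv`
and edge labels `fe` : `w(u) = f(u) + \sum_{e incident to u} f(e)`. -/
def latWeight (G : SimpleGraph V) [DecidableRel G.Adj]
    (fv : V → ℕ) (fe : Sym2 V → ℕ) (u : V) : ℕ :=
  fv u + ∑ v ∈ G.neighborFinset u, fe s(u, v)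

/-- `fv, fe` together form a bijection from `V(G) ∪ E(G)` onto `{1, …, p + q}`,
where `p` is the order and `q` is the size of `G`. -/
def IsTotalLabeling (G : SimpleGraph V) [DecidableRel G.Adj]
    (fv : V → ℕ) (fe : Sym2 V → ℕ) : Prop :=
  Set.BijOn (Sum.elim fv (fun e : G.edgeSet => fe (e : Sym2 V))) Set.univ
    (Set.Icc 1 (Fintype.card V + G.edgeFinset.card))

/-- A local antimagic total labeling of `G` : a bijective total labeling such that any two
adjacent vertices get distinct weights. -/
def IsLocalAntimagicTotal (G : SimpleGraph V) [DecidableRel G.Adj]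
    (fv : V → ℕ) (fe : Sym2 V → ℕ) : Prop :=
  IsTotalLabeling G fv fe ∧
    ∀ ⦃u v : V⦄, G.Adj u v → latWeight G fv fe u ≠ latWeight G fv fe v

/-- The local antimagic total chromatic number `χ_lat(G)` : the minimum number of distinct
vertex weights taken over all local antimagic total labelings of `G`. -/
noncomputable def chiLat (G : SimpleGraph V) [DecidableRel G.Adj] : ℕ :=
  sInf {c | ∃ fv fe, IsLocalAntimagicTotal G fv fe ∧
    (Finset.univ.image (latWeight G fv fe)).card = c}

instance {W : Type*} (r : W → W → Prop) [DecidableEq W] [DecidableRel r] :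
    DecidableRel (SimpleGraph.fromRel r).Adj :=
  fun a b => decidable_of_iff _ (SimpleGraph.fromRel_adj r a b).symm

instance (n : ℕ) : DecidableRel (SimpleGraph.pathGraph n).Adj :=
  fun _ _ => decidable_of_iff _ SimpleGraph.pathGraph_adj.symm

/-- Edge labels on a path: the edge between `i - 1` and `i` gets the label `g i`. -/
def pathEdge (n : ℕ) (g : ℕ → ℕ) : Sym2 (Fin n) → ℕ :=
  Sym2.lift ⟨fun a b => g (max a.val b.val), fun a b => by
    show g (max a.val b.val) = g (max b.val a.val)
    rw [max_comm]⟩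

theorem pathEdge_mk {n : ℕ} (g : ℕ → ℕ) (a b : Fin n) :
    pathEdge n g s(a, b) = g (max a.val b.val) := rfl

theorem path_weight {n : ℕ} (g h : ℕ → ℕ) (g0 : g 0 = 0) (gn : g n = 0) (u : Fin n) :
    latWeight (SimpleGraph.pathGraph n) (fun i => h i.val) (pathEdge n g) u
      = h u + g u + g (u + 1) := by
  unfold latWeight
  have e1 : ∑ v ∈ (SimpleGraph.pathGraph n).neighborFinset u, pathEdge n g s(u, v)
      = ∑ v : Fin n, ((if v.val + 1 = u.val then g u else 0)
        + (if u.val + 1 = v.val then g (u + 1) else 0)) := by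
    rw [SimpleGraph.neighborFinset_eq_filter, Finset.sum_filter]
    refine Finset.sum_congr rfl fun v _ => ?_
    rw [pathEdge_mk]
    simp only [SimpleGraph.pathGraph_adj]
    by_cases h1 : v.val + 1 = u.val
    · have h2 : ¬ (u.val + 1 = v.val) := by omega
      have h3 : max u.val v.val = u.val := by omega
      simp [h1, h2, h3]
    · by_cases h2 : u.val + 1 = v.val
      · have h3 : max u.val v.val = u.val + 1 := by omega
        simp [h1, h2, h3]
      · simp [h1, h2]
  have e2 : ∑ v : Fin n, (if v.val + 1 = u.val then g u else 0) = g u := by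
    by_cases hu : u.val = 0
    · simp [hu, g0]
    · rw [Finset.sum_eq_single (⟨u.val - 1, by omega⟩ : Fin n)]
      · rw [if_pos]
        show u.val - 1 + 1 = u.val
        omega
      · intro b _ hb
        rw [if_neg]
        intro hc
        apply hb
        ext
        show b.val = u.val - 1
        omega
      · simp
  have e3 : ∑ v : Fin n, (if u.val + 1 = v.val then g (u + 1) else 0) = g (u + 1) := by
    by_cases hu : u.val + 1 = n
    · simp [hu, gn]
    · rw [Finset.sum_eq_single (⟨u.val + 1, by omega⟩ : Fin n)]
      · rw [if_pos rfl]
      · intro b _ hb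
        rw [if_neg]
        intro hc
        apply hb
        ext
        exact hc.symm
      · simp
  rw [e1, Finset.sum_add_distrib, e2, e3, add_assoc]

theorem path_edge_form {n : ℕ} (e : Sym2 (Fin n)) (he : e ∈ (SimpleGraph.pathGraph n).edgeSet) :
    ∃ i : ℕ, ∃ hi : i + 1 < n, e = s((⟨i, by omega⟩ : Fin n), (⟨i + 1, hi⟩ : Fin n)) := by
  induction e using Sym2.ind with
  | _ a b =>
    rw [SimpleGraph.mem_edgeSet, SimpleGraph.pathGraph_adj] at he
    obtain ⟨a, ha⟩ := a
    obtain ⟨b, hb⟩ := b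
    simp only at he
    rcases he with he | he
    · subst he
      exact ⟨a, hb, rfl⟩
    · subst he
      exact ⟨b, ha, Sym2.eq_swap⟩

theorem path_total {n : ℕ} (hn : 2 ≤ n) (g h : ℕ → ℕ)
    (hr : ∀ i, i < n → 1 ≤ h i ∧ h i ≤ 2 * n - 1)
    (gr : ∀ i, 0 < i → i < n → 1 ≤ g i ∧ g i ≤ 2 * n - 1)
    (hi : ∀ i j, i < n → j < n → h i = h j → i = j)
    (gi : ∀ i j, 0 < i → i < n → 0 < j → j < n → g i = g j → i = j)
    (hg : ∀ i j, i < n → 0 < j → j < n → h i ≠ g j) :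
    IsTotalLabeling (SimpleGraph.pathGraph n) (fun i => h i.val) (pathEdge n g) := by
  have hc : n - 1 ≤ (SimpleGraph.pathGraph n).edgeFinset.card := by
    obtain ⟨m, rfl⟩ : ∃ m, n = m + 1 := ⟨n - 1, by omega⟩
    have := (SimpleGraph.pathGraph_connected m).card_vert_le_card_edgeSet_add_one
    rw [Nat.card_eq_fintype_card, Nat.card_eq_fintype_card, Fintype.card_fin,
      ← SimpleGraph.edgeFinset_card] at this
    omega
  have hmap : Set.MapsTo (Sum.elim (fun i : Fin n => h i.val)
      (fun e : (SimpleGraph.pathGraph n).edgeSet => pathEdge n g (e : Sym2 (Fin n)))) Set.univ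
      (Set.Icc 1 (Fintype.card (Fin n) + (SimpleGraph.pathGraph n).edgeFinset.card)) := by
    rintro (i | ⟨e, he⟩) -
    · have := hr i i.2
      simp only [Sum.elim_inl, Set.mem_Icc, Fintype.card_fin]
      omega
    · obtain ⟨i, hilt, rfl⟩ := path_edge_form e he
      have := gr (i + 1) (by omega) hilt
      simp only [Sum.elim_inr, Set.mem_Icc, Fintype.card_fin, pathEdge_mk]
      rw [max_eq_right (by omega)]
      omega
  have hinj : Function.Injective (Sum.elim (fun i : Fin n => h i.val)
      (fun e : (SimpleGraph.pathGraph n).edgeSet => pathEdge n g (e : Sym2 (Fin n)))) := by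
    rintro (i | ⟨e, he⟩) (j | ⟨eb, hedge⟩) hij
    · rw [Fin.ext (hi i j i.2 j.2 hij)]
    · obtain ⟨a, ha, rfl⟩ := path_edge_form eb hedge
      simp only [Sum.elim_inr, Sum.elim_inl, pathEdge_mk] at hij
      rw [max_eq_right (by omega)] at hij
      exact absurd hij (hg _ _ i.2 (by omega) ha)
    · obtain ⟨a, ha, rfl⟩ := path_edge_form e he
      simp only [Sum.elim_inr, Sum.elim_inl, pathEdge_mk] at hij
      rw [max_eq_right (by omega)] at hij
      exact absurd hij.symm (hg _ _ j.2 (by omega) ha)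
    · obtain ⟨a, ha, rfl⟩ := path_edge_form e he
      obtain ⟨b, hb, rfl⟩ := path_edge_form eb hedge
      simp only [Sum.elim_inr, pathEdge_mk] at hij
      rw [max_eq_right (by omega), max_eq_right (by omega)] at hij
      have := gi _ _ (by omega) ha (by omega) hb hij
      obtain rfl : a = b := by omega
      rfl
  refine ⟨hmap, hinj.injOn, ?_⟩
  have := Set.eq_of_subset_of_ncard_le hmap.image_subset (by
    rw [Set.ncard_image_of_injective _ hinj, Set.ncard_univ, Nat.card_eq_fintype_card,
      Fintype.card_sum, ← SimpleGraph.edgeFinset_card, ← Finset.coe_Icc, Set.ncard_coe_finset,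
      Nat.card_Icc]
    omega) (Set.finite_Icc _ _)
  exact this.ge

theorem path_two_le {n : ℕ} (hn : 2 ≤ n) (fv : Fin n → ℕ) (fe : Sym2 (Fin n) → ℕ)
    (hf : IsLocalAntimagicTotal (SimpleGraph.pathGraph n) fv fe) :
    2 ≤ (Finset.univ.image (latWeight (SimpleGraph.pathGraph n) fv fe)).card := by
  have hadj : (SimpleGraph.pathGraph n).Adj ⟨0, by omega⟩ ⟨1, by omega⟩ := by
    rw [SimpleGraph.pathGraph_adj]
    simp
  have := hf.2 hadj
  exact Finset.one_lt_card.2 ⟨_, Finset.mem_image_of_mem _ (Finset.mem_univ _), _,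
    Finset.mem_image_of_mem _ (Finset.mem_univ _), this⟩

/-- Criterion: a suitable pair of label sequences shows that the number is two. -/
theorem path_key {n : ℕ} (hn : 2 ≤ n) (A B : ℕ) (hAB : A ≠ B) (g h : ℕ → ℕ)
    (g0 : g 0 = 0) (gn : g n = 0)
    (hA : ∀ i, i < n → i % 2 = 0 → h i + g i + g (i + 1) = A)
    (hB : ∀ i, i < n → i % 2 = 1 → h i + g i + g (i + 1) = B)
    (hr : ∀ i, i < n → 1 ≤ h i ∧ h i ≤ 2 * n - 1)
    (gr : ∀ i, 0 < i → i < n → 1 ≤ g i ∧ g i ≤ 2 * n - 1)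
    (hi : ∀ i j, i < n → j < n → h i = h j → i = j)
    (gi : ∀ i j, 0 < i → i < n → 0 < j → j < n → g i = g j → i = j)
    (hg : ∀ i j, i < n → 0 < j → j < n → h i ≠ g j) :
    chiLat (SimpleGraph.pathGraph n) = 2 := by
  have hw : ∀ u : Fin n, latWeight (SimpleGraph.pathGraph n) (fun i => h i.val) (pathEdge n g) u
      = if u.val % 2 = 0 then A else B := by
    intro u
    rw [path_weight g h g0 gn]
    split_ifs with hu
    · exact hA u u.2 hu
    · exact hB u u.2 (by omega)
  have hf : IsLocalAntimagicTotal (SimpleGraph.pathGraph n) (fun i => h i.val) (pathEdge n g) := by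
    refine ⟨path_total hn g h hr gr hi gi hg, ?_⟩
    intro u v huv
    rw [SimpleGraph.pathGraph_adj] at huv
    rw [hw, hw]
    split_ifs <;> first | exact hAB | exact hAB.symm | (exfalso; omega)
  have hcard : (Finset.univ.image (latWeight (SimpleGraph.pathGraph n)
      (fun i => h i.val) (pathEdge n g))).card = 2 := by
    apply le_antisymm _ (path_two_le hn _ _ hf)
    refine (Finset.card_le_card (t := {A, B}) ?_).trans Finset.card_le_two
    intro x hx
    obtain ⟨u, -, rfl⟩ := Finset.mem_image.1 hx
    rw [hw]
    split_ifs <;> simp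
  apply le_antisymm
  · exact Nat.sInf_le ⟨_, _, hf, hcard⟩
  · refine le_csInf ⟨_, _, _, hf, hcard⟩ ?_
    rintro c ⟨fv, fe, hlab, rfl⟩
    exact path_two_le hn _ _ hlab

/-- Same criterion, with vertex labels computed from edge labels. -/
theorem path_key_of_or {n : ℕ} (hn : 2 ≤ n) (A B : ℕ) (hAB : A ≠ B) (g h : ℕ → ℕ)
    (g0 : g 0 = 0) (gn : g n = 0)
    (hh : ∀ i, i < n → (i % 2 = 0 ∧ h i + g i + g (i + 1) = A) ∨
      (i % 2 = 1 ∧ h i + g i + g (i + 1) = B))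
    (hr : ∀ i, i < n → 1 ≤ h i ∧ h i ≤ 2 * n - 1)
    (gr : ∀ i, 0 < i → i < n → 1 ≤ g i ∧ g i ≤ 2 * n - 1)
    (hi : ∀ i j, i < n → j < n → h i = h j → i = j)
    (gi : ∀ i j, 0 < i → i < n → 0 < j → j < n → g i = g j → i = j)
    (hg : ∀ i j, i < n → 0 < j → j < n → h i ≠ g j) :
    chiLat (SimpleGraph.pathGraph n) = 2 := by
  refine path_key hn A B hAB g h g0 gn ?_ ?_ hr gr hi gi hg
  · intro i h1 h2
    rcases hh i h1 with h3 | h3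
    · exact h3.2
    · omega
  · intro i h1 h2
    rcases hh i h1 with h3 | h3
    · omega
    · exact h3.2


set_option maxHeartbeats 2000000 in
theorem path_case_two (k : ℕ) : chiLat (SimpleGraph.pathGraph (4 * k + 2)) = 2 := by
  obtain ⟨g, hgdef⟩ : ∃ g : ℕ → ℕ, ∀ i, g i = if i = 4 * k + 2 then 0 else
      if i % 4 = 1 then 4 * k + 1 - i / 4 else if i % 4 = 3 then 3 * k - i / 4 else i / 2 := ⟨_, fun _ => rfl⟩
  have g0 : g 0 = 0 := by
    rw [hgdef]; simp
  have gn : g (4 * k + 2) = 0 := by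
    rw [hgdef, if_pos rfl]
  have gs : ∀ i, i < 4 * k + 2 → (i % 2 = 0 ∧ g i = i / 2) ∨ (i % 4 = 1 ∧ g i + i / 4 = 4 * k + 1) ∨
      (i % 4 = 3 ∧ g i + i / 4 = 3 * k) := by
    intro i hi
    rw [hgdef]
    split_ifs <;> omega
  obtain ⟨h, hh⟩ : ∃ h : ℕ → ℕ, ∀ i, h i =
      if i = 4 * k + 1 then 9 * k + 3 - i / 4 else
      if i % 4 = 0 then 5 * k + 2 - i / 4 else
      if i % 4 = 1 ∧ i < 4 * k then 7 * k + 2 - i / 4 else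
      if i % 4 = 2 then 6 * k + 2 - i / 4 else
      8 * k + 2 - i / 4 := ⟨_, fun _ => rfl⟩
  have hs : ∀ i, i < 4 * k + 2 →
      (i % 4 = 0 ∧ h i + i / 4 = 5 * k + 2) ∨
      (i % 4 = 1 ∧ i < 4 * k ∧ h i + i / 4 = 7 * k + 2) ∨
      (i % 4 = 2 ∧ h i + i / 4 = 6 * k + 2) ∨
      (i % 4 = 3 ∧ h i + i / 4 = 8 * k + 2) ∨
      (i = 4 * k + 1 ∧ h i + i / 4 = 9 * k + 3) := by
    intro i hi
    rw [hh]
    split_ifs <;> omega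
  refine path_key_of_or (by omega) (9 * k + 3) (11 * k + 4) (by omega) g h g0 gn ?_ ?_ ?_ ?_ ?_ ?_
  · intro i hi
    have h1 := gs i hi
    have h2 : i + 1 = 4 * k + 2 ∨ i + 1 < 4 * k + 2 := by omega
    have h4 := hs i hi
    rcases h2 with h2 | h2
    · rw [h2, gn]
      rcases h1 with h1 | h1 | h1 <;> rcases h4 with h4 | h4 | h4 | h4 | h4 <;> omega
    · have h3 := gs (i + 1) h2
      rcases h1 with h1 | h1 | h1 <;> rcases h4 with h4 | h4 | h4 | h4 | h4 <;>
        first | (exfalso; omega) | (rcases h3 with h3 | h3 | h3 <;> omega)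
  · intro i hi
    have h4 := hs i hi
    omega
  · intro i h0 hi
    have h4 := gs i hi
    omega
  · intro i j hi hj hij
    have h4 := hs i hi
    have h5 := hs j hj
    rcases h4 with h4 | h4 | h4 | h4 | h4 <;> rcases h5 with h5 | h5 | h5 | h5 | h5 <;> omega
  · intro i j _ hi _ hj hij
    have h4 := gs i hi
    have h5 := gs j hj
    rcases h4 with h4 | h4 | h4 <;> rcases h5 with h5 | h5 | h5 <;> omega
  · intro i j hi _ hj hij
    have h4 := hs i hi
    have h5 := gs j hj
    rcases h4 with h4 | h4 | h4 | h4 | h4 <;> rcases h5 with h5 | h5 | h5 <;> omega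

set_option maxHeartbeats 2000000 in
theorem path_case_zero (k : ℕ) (hk : 2 ≤ k) : chiLat (SimpleGraph.pathGraph (4 * k)) = 2 := by
  obtain ⟨g, hgdef⟩ : ∃ g : ℕ → ℕ, ∀ i, g i = if i = 4 * k then 0 else
      if i % 4 = 1 then 3 * k - 1 - i / 4 else if i % 4 = 3 then 6 * k - 1 - i / 4 else i / 2 := ⟨_, fun _ => rfl⟩
  have g0 : g 0 = 0 := by
    rw [hgdef]; simp
  have gn : g (4 * k) = 0 := by
    rw [hgdef, if_pos rfl]
  have gs : ∀ i, i < 4 * k → (i % 2 = 0 ∧ g i = i / 2) ∨ (i % 4 = 1 ∧ g i + i / 4 = 3 * k - 1) ∨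
      (i % 4 = 3 ∧ g i + i / 4 = 6 * k - 1) := by
    intro i hi
    rw [hgdef]
    split_ifs <;> omega
  obtain ⟨h, hh⟩ : ∃ h : ℕ → ℕ, ∀ i, h i =
      if i + 1 = 4 * k then 6 * k - 2 - i / 4 else
      if i % 4 = 0 then 8 * k - 1 - i / 4 else
      if i % 4 = 1 then 7 * k - 1 - i / 4 else
      if i % 4 = 2 then 5 * k - 2 - i / 4 else
      4 * k - 2 - i / 4 := ⟨_, fun _ => rfl⟩
  have hs : ∀ i, i < 4 * k →
      (i % 4 = 0 ∧ h i + i / 4 = 8 * k - 1) ∨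
      (i % 4 = 1 ∧ h i + i / 4 = 7 * k - 1) ∨
      (i % 4 = 2 ∧ h i + i / 4 = 5 * k - 2) ∨
      (i % 4 = 3 ∧ i + 1 < 4 * k ∧ h i + i / 4 = 4 * k - 2) ∨
      (i + 1 = 4 * k ∧ h i + i / 4 = 6 * k - 2) := by
    intro i hi
    rw [hh]
    split_ifs <;> omega
  refine path_key_of_or (by omega) (11 * k - 2) (10 * k - 1) (by omega) g h g0 gn ?_ ?_ ?_ ?_ ?_ ?_
  · intro i hi
    have h1 := gs i hi
    have h2 : i + 1 = 4 * k ∨ i + 1 < 4 * k := by omega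
    have h4 := hs i hi
    rcases h2 with h2 | h2
    · rw [h2, gn]
      rcases h1 with h1 | h1 | h1 <;> rcases h4 with h4 | h4 | h4 | h4 | h4 <;> omega
    · have h3 := gs (i + 1) h2
      rcases h1 with h1 | h1 | h1 <;> rcases h4 with h4 | h4 | h4 | h4 | h4 <;>
        first | (exfalso; omega) | (rcases h3 with h3 | h3 | h3 <;> omega)
  · intro i hi
    have h4 := hs i hi
    omega
  · intro i h0 hi
    have h4 := gs i hi
    omega
  · intro i j hi hj hij
    have h4 := hs i hi
    have h5 := hs j hj
    rcases h4 with h4 | h4 | h4 | h4 | h4 <;> rcases h5 with h5 | h5 | h5 | h5 | h5 <;> omega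
  · intro i j _ hi _ hj hij
    have h4 := gs i hi
    have h5 := gs j hj
    rcases h4 with h4 | h4 | h4 <;> rcases h5 with h5 | h5 | h5 <;> omega
  · intro i j hi _ hj hij
    have h4 := hs i hi
    have h5 := gs j hj
    rcases h4 with h4 | h4 | h4 | h4 | h4 <;> rcases h5 with h5 | h5 | h5 <;> omega

set_option maxHeartbeats 2000000 in
theorem path_case_three (k : ℕ) : chiLat (SimpleGraph.pathGraph (4 * k + 3)) = 2 := by
  obtain ⟨g, hgdef⟩ : ∃ g : ℕ → ℕ, ∀ i, g i = if i = 4 * k + 3 then 0 else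
      if i % 4 = 1 then 7 * k + 4 - i / 4 else if i % 4 = 3 then 4 * k + 2 - i / 4 else i / 2 := ⟨_, fun _ => rfl⟩
  have g0 : g 0 = 0 := by
    rw [hgdef]; simp
  have gn : g (4 * k + 3) = 0 := by
    rw [hgdef, if_pos rfl]
  have gs : ∀ i, i < 4 * k + 3 → (i % 2 = 0 ∧ g i = i / 2) ∨ (i % 4 = 1 ∧ g i + i / 4 = 7 * k + 4) ∨
      (i % 4 = 3 ∧ g i + i / 4 = 4 * k + 2) := by
    intro i hi
    rw [hgdef]
    split_ifs <;> omega
  obtain ⟨h, hh⟩ : ∃ h : ℕ → ℕ, ∀ i, h i =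
      if i = 4 * k + 2 then 9 * k + 5 - i / 4 else
      if i % 4 = 0 then 3 * k + 2 - i / 4 else
      if i % 4 = 1 then 5 * k + 3 - i / 4 else
      if i % 4 = 2 ∧ i < 4 * k then 6 * k + 3 - i / 4 else
      8 * k + 4 - i / 4 := ⟨_, fun _ => rfl⟩
  have hs : ∀ i, i < 4 * k + 3 →
      (i % 4 = 0 ∧ h i + i / 4 = 3 * k + 2) ∨
      (i % 4 = 1 ∧ h i + i / 4 = 5 * k + 3) ∨
      (i % 4 = 2 ∧ i < 4 * k ∧ h i + i / 4 = 6 * k + 3) ∨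
      (i % 4 = 3 ∧ h i + i / 4 = 8 * k + 4) ∨
      (i = 4 * k + 2 ∧ h i + i / 4 = 9 * k + 5) := by
    intro i hi
    rw [hh]
    split_ifs <;> omega
  refine path_key_of_or (by omega) (10 * k + 6) (12 * k + 8) (by omega) g h g0 gn ?_ ?_ ?_ ?_ ?_ ?_
  · intro i hi
    have h1 := gs i hi
    have h2 : i + 1 = 4 * k + 3 ∨ i + 1 < 4 * k + 3 := by omega
    have h4 := hs i hi
    rcases h2 with h2 | h2
    · rw [h2, gn]
      rcases h1 with h1 | h1 | h1 <;> rcases h4 with h4 | h4 | h4 | h4 | h4 <;> omega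
    · have h3 := gs (i + 1) h2
      rcases h1 with h1 | h1 | h1 <;> rcases h4 with h4 | h4 | h4 | h4 | h4 <;>
        first | (exfalso; omega) | (rcases h3 with h3 | h3 | h3 <;> omega)
  · intro i hi
    have h4 := hs i hi
    omega
  · intro i h0 hi
    have h4 := gs i hi
    omega
  · intro i j hi hj hij
    have h4 := hs i hi
    have h5 := hs j hj
    rcases h4 with h4 | h4 | h4 | h4 | h4 <;> rcases h5 with h5 | h5 | h5 | h5 | h5 <;> omega
  · intro i j _ hi _ hj hij
    have h4 := gs i hi
    have h5 := gs j hj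
    rcases h4 with h4 | h4 | h4 <;> rcases h5 with h5 | h5 | h5 <;> omega
  · intro i j hi _ hj hij
    have h4 := hs i hi
    have h5 := gs j hj
    rcases h4 with h4 | h4 | h4 | h4 | h4 <;> rcases h5 with h5 | h5 | h5 <;> omega

set_option maxHeartbeats 2000000 in
theorem path_case_one (k : ℕ) (hk : 1 ≤ k) : chiLat (SimpleGraph.pathGraph (4 * k + 1)) = 2 := by
  obtain ⟨g, hgdef⟩ : ∃ g : ℕ → ℕ, ∀ i, g i = if i = 4 * k + 1 then 0 else if i + 2 = 4 * k + 1 then 4 * k + 1 else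
      if i % 4 = 1 then 3 * k - i / 4 else if i % 4 = 3 then 4 * k - i / 4 else i / 2 := ⟨_, fun _ => rfl⟩
  have g0 : g 0 = 0 := by
    rw [hgdef]; simp
  have gn : g (4 * k + 1) = 0 := by
    rw [hgdef, if_pos rfl]
  have gs : ∀ i, i < 4 * k + 1 → (i % 2 = 0 ∧ g i = i / 2) ∨ (i % 4 = 1 ∧ g i + i / 4 = 3 * k) ∨
      (i % 4 = 3 ∧ i + 2 ≠ 4 * k + 1 ∧ g i + i / 4 = 4 * k) ∨
      (i + 2 = 4 * k + 1 ∧ g i = 4 * k + 1) := by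
    intro i hi
    rw [hgdef]
    split_ifs <;> omega
  obtain ⟨h, hh⟩ : ∃ h : ℕ → ℕ, ∀ i, h i =
      if i = 4 * k then 8 * k + 1 - i / 4 else
      if i + 2 = 4 * k then 4 * k - i / 4 else
      if i + 1 = 4 * k then 6 * k - i / 4 else
      if i % 4 = 0 ∧ i < 4 * k then 6 * k + 1 - i / 4 else
      if i % 4 = 1 then 8 * k + 1 - i / 4 else
      if i % 4 = 2 ∧ i + 2 < 4 * k then 5 * k - i / 4 else
      7 * k - i / 4 := ⟨_, fun _ => rfl⟩
  have hs : ∀ i, i < 4 * k + 1 →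
      (i % 4 = 0 ∧ i < 4 * k ∧ h i + i / 4 = 6 * k + 1) ∨
      (i % 4 = 1 ∧ h i + i / 4 = 8 * k + 1) ∨
      (i % 4 = 2 ∧ i + 2 < 4 * k ∧ h i + i / 4 = 5 * k) ∨
      (i % 4 = 3 ∧ i + 1 < 4 * k ∧ h i + i / 4 = 7 * k) ∨
      (i = 4 * k ∧ h i + i / 4 = 8 * k + 1) ∨
      (i + 2 = 4 * k ∧ h i + i / 4 = 4 * k) ∨
      (i + 1 = 4 * k ∧ h i + i / 4 = 6 * k) := by
    intro i hi
    rw [hh]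
    split_ifs <;> omega
  refine path_key_of_or (by omega) (9 * k + 1) (11 * k + 2) (by omega) g h g0 gn ?_ ?_ ?_ ?_ ?_ ?_
  · intro i hi
    have h1 := gs i hi
    have h2 : i + 1 = 4 * k + 1 ∨ i + 1 < 4 * k + 1 := by omega
    have h4 := hs i hi
    rcases h2 with h2 | h2
    · rw [h2, gn]
      rcases h1 with h1 | h1 | h1 | h1 <;> rcases h4 with h4 | h4 | h4 | h4 | h4 | h4 | h4 <;> omega
    · have h3 := gs (i + 1) h2
      rcases h1 with h1 | h1 | h1 | h1 <;> rcases h4 with h4 | h4 | h4 | h4 | h4 | h4 | h4 <;>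
        first | (exfalso; omega) | (rcases h3 with h3 | h3 | h3 | h3 <;> omega)
  · intro i hi
    have h4 := hs i hi
    omega
  · intro i h0 hi
    have h4 := gs i hi
    omega
  · intro i j hi hj hij
    have h4 := hs i hi
    have h5 := hs j hj
    rcases h4 with h4 | h4 | h4 | h4 | h4 | h4 | h4 <;> rcases h5 with h5 | h5 | h5 | h5 | h5 | h5 | h5 <;> omega
  · intro i j _ hi _ hj hij
    have h4 := gs i hi
    have h5 := gs j hj
    rcases h4 with h4 | h4 | h4 | h4 <;> rcases h5 with h5 | h5 | h5 | h5 <;> omega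
  · intro i j hi _ hj hij
    have h4 := hs i hi
    have h5 := gs j hj
    rcases h4 with h4 | h4 | h4 | h4 | h4 | h4 | h4 <;> rcases h5 with h5 | h5 | h5 | h5 <;> omega

set_option synthInstance.maxHeartbeats 0 in
set_option synthInstance.maxSize 100000 in
set_option maxHeartbeats 0 in
theorem path_four_finite : ∀ e1 ∈ Finset.Icc 1 7, ∀ e2 ∈ Finset.Icc 1 7, e1 ≠ e2 →
    ∀ e3 ∈ Finset.Icc 1 7, e1 ≠ e3 → e2 ≠ e3 →
    ∀ v1 ∈ Finset.Icc 1 7, v1 ≠ e1 → v1 ≠ e2 → v1 ≠ e3 →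
    ∀ v2 ∈ Finset.Icc 1 7, v2 ≠ e1 → v2 ≠ e2 → v2 ≠ e3 → v2 ≠ v1 →
    ∀ v0 ∈ Finset.Icc 1 7, v0 + e1 = v2 + e2 + e3 →
      v0 ≠ e1 → v0 ≠ e2 → v0 ≠ e3 → v0 ≠ v1 → v0 ≠ v2 →
    ∀ v3 ∈ Finset.Icc 1 7, v3 + e3 = v1 + e1 + e2 →
      v3 ≠ e1 → v3 ≠ e2 → v3 ≠ e3 → v3 ≠ v1 → v3 ≠ v2 → v3 ≠ v0 →
      v0 + e1 = v3 + e3 := by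
  set_option maxRecDepth 100000 in
  decide

theorem path_four_lower (fv : Fin 4 → ℕ) (fe : Sym2 (Fin 4) → ℕ)
    (hf : IsLocalAntimagicTotal (SimpleGraph.pathGraph 4) fv fe) :
    3 ≤ (Finset.univ.image (latWeight (SimpleGraph.pathGraph 4) fv fe)).card := by
  by_contra hlt
  have hle : (Finset.univ.image (latWeight (SimpleGraph.pathGraph 4) fv fe)).card ≤ 2 := by omega
  obtain ⟨⟨hm, hinj, -⟩, hadj⟩ := hf
  have hE : (SimpleGraph.pathGraph 4).edgeFinset.card = 3 := by decide
  have a01 : (SimpleGraph.pathGraph 4).Adj 0 1 := by decide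
  have a12 : (SimpleGraph.pathGraph 4).Adj 1 2 := by decide
  have a23 : (SimpleGraph.pathGraph 4).Adj 2 3 := by decide
  have d01 := hadj a01
  have d12 := hadj a12
  have d23 := hadj a23
  have triple : ∀ x y z : Fin 4,
      latWeight (SimpleGraph.pathGraph 4) fv fe x ≠ latWeight (SimpleGraph.pathGraph 4) fv fe y →
      latWeight (SimpleGraph.pathGraph 4) fv fe y ≠ latWeight (SimpleGraph.pathGraph 4) fv fe z →
      latWeight (SimpleGraph.pathGraph 4) fv fe x = latWeight (SimpleGraph.pathGraph 4) fv fe z := by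
    intro x y z h1 h2
    by_contra h3
    have : 2 < (Finset.univ.image (latWeight (SimpleGraph.pathGraph 4) fv fe)).card :=
      Finset.two_lt_card.2 ⟨_, Finset.mem_image_of_mem _ (Finset.mem_univ x), _,
        Finset.mem_image_of_mem _ (Finset.mem_univ y), _,
        Finset.mem_image_of_mem _ (Finset.mem_univ z), h1, h3, h2⟩
    omega
  have t02 := triple 0 1 2 d01 d12
  have t13 := triple 1 2 3 d12 d23
  have n0 : (SimpleGraph.pathGraph 4).neighborFinset 0 = {1} := by decide
  have n1 : (SimpleGraph.pathGraph 4).neighborFinset 1 = {0, 2} := by decide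
  have n2 : (SimpleGraph.pathGraph 4).neighborFinset 2 = {1, 3} := by decide
  have n3 : (SimpleGraph.pathGraph 4).neighborFinset 3 = {2} := by decide
  have w0 : latWeight (SimpleGraph.pathGraph 4) fv fe 0 = fv 0 + fe s(0, 1) := by
    simp [latWeight, n0]
  have w1 : latWeight (SimpleGraph.pathGraph 4) fv fe 1 = fv 1 + (fe s(0, 1) + fe s(1, 2)) := by
    rw [latWeight, n1, Finset.sum_pair (by decide), Sym2.eq_swap]
  have w2 : latWeight (SimpleGraph.pathGraph 4) fv fe 2 = fv 2 + (fe s(1, 2) + fe s(2, 3)) := by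
    rw [latWeight, n2, Finset.sum_pair (by decide), Sym2.eq_swap]
  have w3 : latWeight (SimpleGraph.pathGraph 4) fv fe 3 = fv 3 + fe s(2, 3) := by
    rw [latWeight, n3, Finset.sum_singleton, Sym2.eq_swap]
  rw [w0, w1] at d01
  rw [w0, w2] at t02
  rw [w1, w3] at t13
  have rv : ∀ i : Fin 4, fv i ∈ Finset.Icc 1 7 := by
    intro i
    have := hm (Set.mem_univ (Sum.inl i))
    rw [hE] at this
    simpa using this
  have re : ∀ a b : Fin 4, (SimpleGraph.pathGraph 4).Adj a b → fe s(a, b) ∈ Finset.Icc 1 7 := by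
    intro a b hab
    have := hm (Set.mem_univ (Sum.inr ⟨s(a, b), hab⟩))
    rw [hE] at this
    simpa using this
  have iv : ∀ i j : Fin 4, i ≠ j → fv i ≠ fv j := by
    intro i j hij hc
    have := hinj (Set.mem_univ (Sum.inl i)) (Set.mem_univ (Sum.inl j)) hc
    exact hij (Sum.inl.inj this)
  have ie : ∀ a b c d : Fin 4, (SimpleGraph.pathGraph 4).Adj a b →
      (SimpleGraph.pathGraph 4).Adj c d → s(a, b) ≠ s(c, d) → fe s(a, b) ≠ fe s(c, d) := by
    intro a b c d hab hcd hne hc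
    have := @hinj (Sum.inr ⟨s(a, b), hab⟩) (Set.mem_univ _) (Sum.inr ⟨s(c, d), hcd⟩)
      (Set.mem_univ _) hc
    exact hne (congrArg Subtype.val (Sum.inr.inj this))
  have ive : ∀ i a b : Fin 4, (SimpleGraph.pathGraph 4).Adj a b → fv i ≠ fe s(a, b) := by
    intro i a b hab hc
    have := @hinj (Sum.inl i) (Set.mem_univ _) (Sum.inr ⟨s(a, b), hab⟩) (Set.mem_univ _) hc
    cases this
  have := path_four_finite _ (re _ _ a01) _ (re _ _ a12) (ie _ _ _ _ a01 a12 (by decide))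
    _ (re _ _ a23) (ie _ _ _ _ a01 a23 (by decide)) (ie _ _ _ _ a12 a23 (by decide))
    _ (rv 1) (ive _ _ _ a01) (ive _ _ _ a12) (ive _ _ _ a23)
    _ (rv 2) (ive _ _ _ a01) (ive _ _ _ a12) (ive _ _ _ a23) (iv _ _ (by decide))
    _ (rv 0) (by omega) (ive _ _ _ a01) (ive _ _ _ a12) (ive _ _ _ a23)
      (iv _ _ (by decide)) (iv _ _ (by decide))
    _ (rv 3) (by omega) (ive _ _ _ a01) (ive _ _ _ a12) (ive _ _ _ a23)
      (iv _ _ (by decide)) (iv _ _ (by decide)) (iv _ _ (by decide))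
  omega

set_option maxHeartbeats 2000000 in
theorem path_case_four : chiLat (SimpleGraph.pathGraph 4) = 3 := by
  let g : ℕ → ℕ := fun i => if i = 4 then 0 else i
  let h : ℕ → ℕ := fun i => if i = 0 then 7 else if i = 1 then 4 else if i = 2 then 6 else 5
  have hw : ∀ u : Fin 4, latWeight (SimpleGraph.pathGraph 4) (fun i => h i.val) (pathEdge 4 g) u
      = h u + g u + g (u + 1) := path_weight g h rfl rfl
  have hf : IsLocalAntimagicTotal (SimpleGraph.pathGraph 4) (fun i => h i.val) (pathEdge 4 g) := by
    refine ⟨path_total (by omega) g h ?_ ?_ ?_ ?_ ?_, ?_⟩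
    · intro i hi
      simp only [h]
      split_ifs <;> omega
    · intro i h0 hi
      simp only [g]
      split_ifs <;> omega
    · intro i j hi hj
      simp only [h]
      split_ifs <;> omega
    · intro i j _ hi _ hj
      simp only [g]
      split_ifs <;> omega
    · intro i j hi _ hj
      simp only [g, h]
      split_ifs <;> omega
    · intro u v
      rw [hw, hw]
      revert u v
      decide
  have hcard : (Finset.univ.image (latWeight (SimpleGraph.pathGraph 4)
      (fun i => h i.val) (pathEdge 4 g))).card = 3 := by
    rw [funext hw]
    decide
  apply le_antisymm
  · exact Nat.sInf_le ⟨_, _, hf, hcard⟩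
  · refine le_csInf ⟨_, _, _, hf, hcard⟩ ?_
    rintro c ⟨fv, fe, hlab, rfl⟩
    exact path_four_lower _ _ hlab

/-- For every integer `n ≥ 2` with `n ≠ 4`, the path `P_n` has local antimagic total
chromatic number `2`, while `χ_lat(P_4) = 3`. -/
theorem chiLat_pathGraph :
    (∀ n : ℕ, 2 ≤ n → n ≠ 4 → chiLat (SimpleGraph.pathGraph n) = 2) ∧
    chiLat (SimpleGraph.pathGraph 4) = 3 := by
  refine ⟨fun n h2 h4 => ?_, path_case_four⟩
  obtain ⟨k, rfl | rfl | rfl | rfl⟩ : ∃ k, n = 4 * k ∨ n = 4 * k + 1 ∨ n = 4 * k + 2 ∨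
      n = 4 * k + 3 := ⟨n / 4, by omega⟩
  · exact path_case_zero k (by omega)
  · exact path_case_one k (by omega)
  · exact path_case_two k
  · exact path_case_three k
end

section
/- The spider Sp(1^[4], 2^[1]) (four legs of length 1 and one leg of length 2) admits no local antimagic total labeling with exactly 2 distinct vertex weights; hence χ_lat(Sp(1^[4], 2)) = 3. -/
open Finset

variable {V : Type*} [Fintype V] [DecidableEq V]

/-- Adjacency for the spider `Sp(1^[m], 2^[n])` : the center `x = none` is adjacent to each
leaf `y i = some (Sum.inl i)` and to each `u j = some (Sum.inr (j, false))`, and each `u j`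
is adjacent to the leaf `v j = some (Sum.inr (j, true))`. -/
def spider12R (m n : ℕ) :
    Option (Fin m ⊕ Fin n × Bool) → Option (Fin m ⊕ Fin n × Bool) → Bool
  | none, some (Sum.inl _) => true
  | none, some (Sum.inr (_, false)) => true
  | some (Sum.inr (j, false)), some (Sum.inr (j', true)) => decide (j = j')
  | _, _ => false

/-- The spider `Sp(1^[m], 2^[n])` with `m` legs of length `1` and `n` legs of length `2`. -/
abbrev spider12 (m n : ℕ) : SimpleGraph (Option (Fin m ⊕ Fin n × Bool)) :=
  SimpleGraph.fromRel (fun a b => spider12R m n a b = true)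

/-- The truncated pairing function used for the lower bound on the edge labels. -/
def pairMin (A r : ℕ) : ℕ := min r (A - r)

/-- Finite search over the centre label, and the labels on the long leg. -/
lemma search_aux : ∀ A ∈ Finset.Icc 14 17, ∀ X ∈ Finset.Icc 1 13, ∀ s ∈ Finset.Icc 1 13,
    ∀ t ∈ Finset.Icc 1 13, s + t < A → 5 * A + X < 91 → X + s < t + (91 - 5 * A - X) →
    X ≠ s → X ≠ t → s ≠ t → X ≠ A - s - t → X ≠ 91 - 5 * A - X →
    91 - 5 * A - X ≠ s → 91 - 5 * A - X ≠ t → 91 - 5 * A - X ≠ A - s - t → 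
    s ≠ A - s - t → t ≠ A - s - t → 91 - 5 * A - X ≤ 13 → A - s - t ≤ 13 →
    2 * (t + (91 - 5 * A - X) - X - s) + (pairMin A X + pairMin A (91 - 5 * A - X) + pairMin A s
      + pairMin A t + pairMin A (A - s - t)) < ∑ r ∈ Finset.Icc 1 13, pairMin A r := by
  decide +kernel

lemma edges_eq : (spider12 4 1).edgeFinset =
    {s(none, some (Sum.inl 0)), s(none, some (Sum.inl 1)), s(none, some (Sum.inl 2)),
     s(none, some (Sum.inl 3)), s(none, some (Sum.inr (0, false))),
     s(some (Sum.inr (0, false)), some (Sum.inr (0, true)))} := by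
  decide +kernel

lemma nbr_x : (spider12 4 1).neighborFinset none =
    {some (Sum.inl 0), some (Sum.inl 1), some (Sum.inl 2), some (Sum.inl 3),
      some (Sum.inr (0, false))} := by decide +kernel

lemma nbr_y (i : Fin 4) : (spider12 4 1).neighborFinset (some (Sum.inl i)) = {none} := by
  revert i; decide +kernel

lemma nbr_u : (spider12 4 1).neighborFinset (some (Sum.inr (0, false))) =
    {none, some (Sum.inr (0, true))} := by decide +kernel

lemma nbr_v : (spider12 4 1).neighborFinset (some (Sum.inr (0, true))) =
    {some (Sum.inr (0, false))} := by decide +kernel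

lemma card_total : Fintype.card (Option (Fin 4 ⊕ Fin 1 × Bool)) +
    (spider12 4 1).edgeFinset.card = 13 := by
  rw [edges_eq]; decide +kernel

lemma sum_labels (fv : Option (Fin 4 ⊕ Fin 1 × Bool) → ℕ)
    (fe : Sym2 (Option (Fin 4 ⊕ Fin 1 × Bool)) → ℕ)
    (h : IsTotalLabeling (spider12 4 1) fv fe) (g : ℕ → ℕ) :
    (∑ v, g (fv v)) + ∑ e ∈ (spider12 4 1).edgeFinset, g (fe e)
      = ∑ r ∈ Finset.Icc 1 13, g r := by
  unfold IsTotalLabeling at h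
  rw [card_total] at h
  have h1 : ∑ e ∈ (spider12 4 1).edgeFinset, g (fe e)
      = ∑ e : (spider12 4 1).edgeSet, g (fe e) := by
    exact Finset.sum_subtype _ (fun x => SimpleGraph.mem_edgeFinset) _
  have h2 : Finset.univ.image (Sum.elim fv (fun e : (spider12 4 1).edgeSet => fe e))
      = Finset.Icc 1 13 := by
    apply Finset.coe_injective
    rw [Finset.coe_image, Finset.coe_univ, Finset.coe_Icc]
    exact h.image_eq
  rw [h1, ← h2, Finset.sum_image (fun a _ b _ hab => h.injOn (Set.mem_univ a) (Set.mem_univ b) hab),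
    Fintype.sum_sum_type]
  rfl

set_option maxHeartbeats 1000000 in
lemma three_le (fv : Option (Fin 4 ⊕ Fin 1 × Bool) → ℕ)
    (fe : Sym2 (Option (Fin 4 ⊕ Fin 1 × Bool)) → ℕ)
    (h : IsLocalAntimagicTotal (spider12 4 1) fv fe) :
    3 ≤ (Finset.univ.image (latWeight (spider12 4 1) fv fe)).card := by
  obtain ⟨hb, hadj⟩ := h
  by_contra hlt
  have key : ∀ a b c : Option (Fin 4 ⊕ Fin 1 × Bool), (spider12 4 1).Adj a b →
      (spider12 4 1).Adj b c →
      latWeight (spider12 4 1) fv fe a = latWeight (spider12 4 1) fv fe c := by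
    intro a b c hab hbc
    by_contra hac
    apply hlt
    have hsub : ({latWeight (spider12 4 1) fv fe a, latWeight (spider12 4 1) fv fe b,
        latWeight (spider12 4 1) fv fe c} : Finset ℕ) ⊆
        Finset.univ.image (latWeight (spider12 4 1) fv fe) := by
      intro z hz
      simp only [Finset.mem_insert, Finset.mem_singleton] at hz
      rcases hz with rfl | rfl | rfl <;> exact Finset.mem_image_of_mem _ (Finset.mem_univ _)
    have := Finset.card_le_card hsub
    rwa [Finset.card_eq_three.mpr ⟨_, _, _, hadj hab, hac, hadj hbc, rfl⟩] at this
  have hy : ∀ i : Fin 4, latWeight (spider12 4 1) fv fe (some (Sum.inl i)) =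
      latWeight (spider12 4 1) fv fe (some (Sum.inr (0, false))) := by
    intro i
    exact key _ none _ (by revert i; decide +kernel) (by decide +kernel)
  have hv := key none (some (Sum.inr (0, false))) (some (Sum.inr (0, true)))
    (by decide +kernel) (by decide +kernel)
  have hy0 := hy 0
  have hy1 := hy 1
  have hy2 := hy 2
  have hy3 := hy 3
  simp only [latWeight, nbr_x, nbr_y, nbr_u, nbr_v] at hy0 hy1 hy2 hy3 hv
  have sw : ∀ a b : Option (Fin 4 ⊕ Fin 1 × Bool), s(a, b) = s(b, a) := fun a b => Sym2.eq_swap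
  rw [Finset.sum_pair (by decide)] at hy0 hy1 hy2 hy3
  simp only [Finset.sum_singleton] at hy0 hy1 hy2 hy3 hv
  simp only [sw (some _) none] at hy0 hy1 hy2 hy3
  rw [sw (some (Sum.inr (0, true)))] at hv
  have hs := sum_labels fv fe hb
  rw [edges_eq] at hs
  have hbd := hb
  unfold IsTotalLabeling at hbd
  rw [card_total] at hbd
  have rv : ∀ v, 1 ≤ fv v ∧ fv v ≤ 13 := fun v => hbd.mapsTo (Set.mem_univ (Sum.inl v))
  have re : ∀ e ∈ (spider12 4 1).edgeSet, 1 ≤ fe e ∧ fe e ≤ 13 := fun e he =>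
    hbd.mapsTo (Set.mem_univ (Sum.inr (⟨e, he⟩ : (spider12 4 1).edgeSet)))
  have dvv : ∀ v w, v ≠ w → fv v ≠ fv w := fun v w hvw heq =>
    hvw (Sum.inl_injective (hbd.injOn (Set.mem_univ (Sum.inl v)) (Set.mem_univ (Sum.inl w)) heq))
  have dve : ∀ v, ∀ e ∈ (spider12 4 1).edgeSet, fv v ≠ fe e := fun v e he heq => by
    have := hbd.injOn (Set.mem_univ (Sum.inl v)) (Set.mem_univ (Sum.inr (⟨e, he⟩ : (spider12 4 1).edgeSet))) heq
    cases this
  have dee : ∀ e ∈ (spider12 4 1).edgeSet, ∀ e' ∈ (spider12 4 1).edgeSet, e ≠ e' →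
      fe e ≠ fe e' := fun e he e' he' hne heq => by
    have := hbd.injOn (Set.mem_univ (Sum.inr (⟨e, he⟩ : (spider12 4 1).edgeSet))) (Set.mem_univ (Sum.inr (⟨e', he'⟩ : (spider12 4 1).edgeSet))) heq
    exact hne (congrArg Subtype.val (Sum.inr_injective this))
  have ms : s(none, some (Sum.inr (0, false))) ∈ (spider12 4 1).edgeSet := by
    rw [SimpleGraph.mem_edgeSet]; decide +kernel
  have mt : s(some (Sum.inr (0, false)), some (Sum.inr (0, true))) ∈ (spider12 4 1).edgeSet := by
    rw [SimpleGraph.mem_edgeSet]; decide +kernel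
  have me : ∀ i : Fin 4, s(none, some (Sum.inl i)) ∈ (spider12 4 1).edgeSet := by
    intro i; rw [SimpleGraph.mem_edgeSet]; revert i; decide +kernel
  have e0 := re _ (me 0)
  have e1 := re _ (me 1)
  have e2 := re _ (me 2)
  have e3 := re _ (me 3)
  have rs := re _ ms
  have rt := re _ mt
  have rX := rv none
  have rU := rv (some (Sum.inr (0, false)))
  have rT := rv (some (Sum.inr (0, true)))
  have d1 := dve none _ ms
  have d2 := dve none _ mt
  have d3 := dee _ ms _ mt (by decide)
  have d4 := dvv none (some (Sum.inr (0, false))) (by decide)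
  have d5 := dvv none (some (Sum.inr (0, true))) (by decide)
  have d6 := dve (some (Sum.inr (0, true))) _ ms
  have d7 := dve (some (Sum.inr (0, true))) _ mt
  have d8 := dvv (some (Sum.inr (0, true))) (some (Sum.inr (0, false))) (by decide)
  have d9 := (dve (some (Sum.inr (0, false))) _ ms).symm
  have d10 := (dve (some (Sum.inr (0, false))) _ mt).symm
  repeat rw [Finset.sum_insert (by decide)] at hv
  simp only [Finset.sum_singleton] at hv
  have hs' : ∀ g : ℕ → ℕ, _ := fun g => by
    have := hs g
    repeat rw [Finset.sum_insert (by decide)] at this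
    simp only [Finset.sum_singleton, Fintype.sum_option, Fintype.sum_sum_type, Fin.sum_univ_four,
      Fintype.sum_prod_type, Fin.sum_univ_one, Fintype.sum_bool] at this
    exact this
  clear hs re rv dvv dve dee ms mt me hbd hb key hlt hadj hy sw
  generalize fv none = X at *
  generalize fv (some (Sum.inr (0, false))) = U at *
  generalize fv (some (Sum.inr (0, true))) = T at *
  generalize fv (some (Sum.inl 0)) = a0 at *
  generalize fv (some (Sum.inl 1)) = a1 at *
  generalize fv (some (Sum.inl 2)) = a2 at *
  generalize fv (some (Sum.inl 3)) = a3 at *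
  generalize fe s(none, some (Sum.inl 0)) = b0 at *
  generalize fe s(none, some (Sum.inl 1)) = b1 at *
  generalize fe s(none, some (Sum.inl 2)) = b2 at *
  generalize fe s(none, some (Sum.inl 3)) = b3 at *
  generalize fe s(none, some (Sum.inr (0, false))) = s at *
  generalize fe s(some (Sum.inr (0, false)), some (Sum.inr (0, true))) = t at *
  obtain ⟨A, hA⟩ : ∃ A, A = U + s + t := ⟨_, rfl⟩
  have hid := hs' id
  have hmin := hs' (pairMin A)
  simp only [id] at hid
  have h91 : ∑ r ∈ Finset.Icc 1 13, r = 91 := by decide +kernel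
  rw [h91] at hid
  have hp : ∀ a b, a + b = A → pairMin A a + pairMin A b ≤ 2 * b := by
    intro a b hab
    unfold pairMin
    omega
  have p0 := hp a0 b0 (by omega)
  have p1 := hp a1 b1 (by omega)
  have p2 := hp a2 b2 (by omega)
  have p3 := hp a3 b3 (by omega)
  have hT : 91 - 5 * A - X = T := by omega
  have hU : A - s - t = U := by omega
  have := search_aux A (Finset.mem_Icc.mpr (by omega)) X (Finset.mem_Icc.mpr rX) s
    (Finset.mem_Icc.mpr rs) t (Finset.mem_Icc.mpr rt)
  rw [hT, hU] at this
  have := this (by omega) (by omega) (by omega) d1 d2 d3 d4 d5 d6 d7 d8 d9 d10 rT.2 rU.2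
  omega

/-- Vertex labels of an optimal labeling. -/
def exV : Option (Fin 4 ⊕ Fin 1 × Bool) → ℕ
  | none => 1
  | some (Sum.inl i) => ![13, 12, 9, 11] i
  | some (Sum.inr (_, false)) => 6
  | some (Sum.inr (_, true)) => 10

/-- Edge labels of an optimal labeling. -/
def exE (e : Sym2 (Option (Fin 4 ⊕ Fin 1 × Bool))) : ℕ :=
  if e = s(none, some (Sum.inl 0)) then 3
  else if e = s(none, some (Sum.inl 1)) then 4
  else if e = s(none, some (Sum.inl 2)) then 7
  else if e = s(none, some (Sum.inl 3)) then 5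
  else if e = s(none, some (Sum.inr (0, false))) then 8
  else 2

lemma ex_total : IsTotalLabeling (spider12 4 1) exV exE := by
  unfold IsTotalLabeling
  rw [card_total]
  have himg : Finset.univ.image (Sum.elim exV (fun e : (spider12 4 1).edgeSet => exE e))
      = Finset.Icc 1 13 := by
    decide +kernel
  have hinj : Function.Injective
      (Sum.elim exV (fun e : (spider12 4 1).edgeSet => exE e)) := by
    rw [← Set.injOn_univ, ← Finset.coe_univ, ← Finset.card_image_iff, himg]
    decide +kernel
  have himg' := congrArg (fun t : Finset ℕ => (t : Set ℕ)) himg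
  simp only [Finset.coe_image, Finset.coe_univ, Finset.coe_Icc] at himg'
  rw [← himg']
  exact hinj.injOn.bijOn_image

theorem chiLat_spider12_four_one :
    (∀ fv fe, IsLocalAntimagicTotal (spider12 4 1) fv fe →
      (Finset.univ.image (latWeight (spider12 4 1) fv fe)).card ≠ 2) ∧
    chiLat (spider12 4 1) = 3 := by
  refine ⟨fun fv fe h => ?_, ?_⟩
  · have := three_le fv fe h
    omega
  · have hmem : 3 ∈ {c | ∃ fv fe, IsLocalAntimagicTotal (spider12 4 1) fv fe ∧
        (Finset.univ.image (latWeight (spider12 4 1) fv fe)).card = c} :=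
      ⟨exV, exE, ⟨ex_total, by decide +kernel⟩, by decide +kernel⟩
    refine le_antisymm (Nat.sInf_le hmem) (le_csInf ⟨3, hmem⟩ ?_)
    rintro c ⟨fv, fe, h, rfl⟩
    exact three_le fv fe h
end

section
/- For every odd integer a ≥ 3 and even integer b ≥ 2, the unicyclic graph G obtained as the one point union of the cycle C_a and the path P_b (identifying one vertex of C_a with an end-vertex of P_b), which has order and size a + b, satisfies χ_lat(G) = 3. In particular, there exist infinitely many unicyclic tripartite graphs with local antimagic total chromatic number 3. -/
open Finset

variable {V : Type*} [Fintype V] [DecidableEq V]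

/-- Adjacency for the one point union of the cycle `C_a` (on `Sum.inl i`, `i : Fin a`) and a
pendant path with `b` further vertices (`Sum.inr j`, `j : Fin b`) attached at the cycle vertex
`Sum.inl 0`; together with the junction vertex the pendant vertices form the path `P_b`.
The resulting graph has order `a + b` and size `a + b`. -/
def cyclePathR (a b : ℕ) : Fin a ⊕ Fin b → Fin a ⊕ Fin b → Bool
  | Sum.inl i, Sum.inl i' => decide ((i' : ℕ) = ((i : ℕ) + 1) % a)
  | Sum.inl i, Sum.inr j => decide ((i : ℕ) = 0 ∧ (j : ℕ) = 0)
  | Sum.inr j, Sum.inr j' => decide ((j' : ℕ) = (j : ℕ) + 1)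
  | _, _ => false

/-- The one point union of the cycle `C_a` and the path `P_b`. -/
abbrev cyclePathGraph (a b : ℕ) : SimpleGraph (Fin a ⊕ Fin b) :=
  SimpleGraph.fromRel (fun x y => cyclePathR a b x y = true)


namespace CPaux

/-- position of a vertex along the unfolded trail, in `1..a+b` -/
def pos (a b : ℕ) : Fin a ⊕ Fin b → ℕ
  | Sum.inl i => b + 1 + i
  | Sum.inr j => b - j

/-- edge labels along the trail -/
def E (m i : ℕ) : ℕ := if i % 2 = 1 then 2 * m + 1 - i / 2 else m + 1 - i / 2

/-- vertex labels along the trail -/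
def F (m i : ℕ) : ℕ :=
  if i = 1 then 4 * m + 2 else if i % 2 = 0 then 2 * m + 1 + i else 2 * m + i - 1

/-- edge label from the positions of the end points -/
def g (m x y : ℕ) : ℕ :=
  if y = x + 1 then E m x else if x = y + 1 then E m y else E m (2 * m + 1)

lemma g_comm (m x y : ℕ) : g m x y = g m y x := by
  unfold g; split_ifs <;> first | rfl | omega

/-- edge labels -/
def fe (a b m : ℕ) : Sym2 (Fin a ⊕ Fin b) → ℕ :=
  Sym2.lift ⟨fun u v => g m (pos a b u) (pos a b v), fun _ _ => g_comm _ _ _⟩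

lemma fe_mk (a b m : ℕ) (u v : Fin a ⊕ Fin b) :
    fe a b m s(u, v) = g m (pos a b u) (pos a b v) := rfl

lemma pos_inj {a b : ℕ} {u v : Fin a ⊕ Fin b} (h : pos a b u = pos a b v) : u = v := by
  rcases u with i | i <;> rcases v with j | j <;> simp only [pos] at h
  · congr 1; ext; omega
  · omega
  · omega
  · congr 1; ext; omega

lemma pos_mem {a b : ℕ} (u : Fin a ⊕ Fin b) : 1 ≤ pos a b u ∧ pos a b u ≤ a + b := by
  rcases u with i | i <;> simp only [pos] <;> omega

lemma pos_surj {a b : ℕ} (k : ℕ) (h1 : 1 ≤ k) (h2 : k ≤ a + b) : ∃ u, pos a b u = k := by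
  by_cases h : k ≤ b
  · exact ⟨Sum.inr ⟨b - k, by omega⟩, by simp only [pos]; omega⟩
  · exact ⟨Sum.inl ⟨k - (b + 1), by omega⟩, by simp only [pos]; omega⟩

lemma adj_iff {a b : ℕ} (ha3 : 3 ≤ a) (u v : Fin a ⊕ Fin b) :
    (cyclePathGraph a b).Adj u v ↔
      (pos a b v = pos a b u + 1 ∨ pos a b u = pos a b v + 1 ∨
        (pos a b u = b + 1 ∧ pos a b v = a + b) ∨ (pos a b v = b + 1 ∧ pos a b u = a + b)) := by
  have hmod : ∀ i : Fin a, ((i : ℕ) + 1) % a = if (i : ℕ) + 1 = a then 0 else (i : ℕ) + 1 := by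
    intro i
    split_ifs with h
    · rw [h]; exact Nat.mod_self a
    · exact Nat.mod_eq_of_lt (by omega)
  rw [SimpleGraph.fromRel_adj]
  rcases u with i | i <;> rcases v with j | j <;>
    simp only [pos, cyclePathR, hmod, ne_eq, decide_eq_true_eq, Sum.inl.injEq, Sum.inr.injEq,
      Fin.ext_iff, reduceCtorEq, not_false_eq_true, true_and, Bool.false_eq_true, or_false,
      false_or]
  · split_ifs <;> omega
  · omega
  · omega
  · omega

lemma g_succ (m x : ℕ) : g m x (x + 1) = E m x := by simp [g]

lemma g_succ' (m x : ℕ) : g m (x + 1) x = E m x := by rw [g_comm, g_succ]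

/-- every edge sits at a trail index -/
lemma edge_cases {a b : ℕ} (ha3 : 3 ≤ a) (e : Sym2 (Fin a ⊕ Fin b))
    (he : e ∈ (cyclePathGraph a b).edgeSet) :
    ∃ u v, e = s(u, v) ∧ (pos a b v = pos a b u + 1 ∨
      (pos a b u = a + b ∧ pos a b v = b + 1)) := by
  induction e with
  | _ u v =>
    rw [SimpleGraph.mem_edgeSet, adj_iff ha3] at he
    rcases he with h | h | h | h
    · exact ⟨u, v, rfl, Or.inl h⟩
    · exact ⟨v, u, Sym2.eq_swap, Or.inl h⟩
    · exact ⟨v, u, Sym2.eq_swap, Or.inr ⟨h.2, h.1⟩⟩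
    · exact ⟨u, v, rfl, Or.inr ⟨h.2, h.1⟩⟩

lemma E_inj {m i j : ℕ} (hi : 1 ≤ i) (hi' : i ≤ 2 * m + 1) (hj : 1 ≤ j) (hj' : j ≤ 2 * m + 1)
    (h : E m i = E m j) : i = j := by
  unfold E at h; split_ifs at h <;> omega

lemma F_inj {m i j : ℕ} (hi : 1 ≤ i) (hi' : i ≤ 2 * m + 1) (hj : 1 ≤ j) (hj' : j ≤ 2 * m + 1)
    (h : F m i = F m j) : i = j := by
  unfold F at h; split_ifs at h <;> omega

lemma E_mem {m i : ℕ} (hi : 1 ≤ i) (hi' : i ≤ 2 * m + 1) : 1 ≤ E m i ∧ E m i ≤ 2 * m + 1 := by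
  unfold E; split_ifs <;> omega

lemma F_mem {m i : ℕ} (hi : 1 ≤ i) (hi' : i ≤ 2 * m + 1) :
    2 * m + 2 ≤ F m i ∧ F m i ≤ 4 * m + 2 := by
  unfold F; split_ifs <;> omega

lemma E_surj {m k : ℕ} (hk : 1 ≤ k) (hk' : k ≤ 2 * m + 1) :
    ∃ i, 1 ≤ i ∧ i ≤ 2 * m + 1 ∧ E m i = k := by
  by_cases h : m + 1 ≤ k
  · exact ⟨2 * (2 * m + 1 - k) + 1, by omega, by omega, by unfold E; split_ifs <;> omega⟩
  · exact ⟨2 * (m + 1 - k), by omega, by omega, by unfold E; split_ifs <;> omega⟩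

lemma F_surj {m k : ℕ} (hk : 2 * m + 2 ≤ k) (hk' : k ≤ 4 * m + 2) :
    ∃ i, 1 ≤ i ∧ i ≤ 2 * m + 1 ∧ F m i = k := by
  by_cases h : k = 4 * m + 2
  · exact ⟨1, by omega, by omega, by simp [F, h]⟩
  by_cases h2 : k % 2 = 1
  · exact ⟨k - (2 * m + 1), by omega, by omega, by unfold F; split_ifs <;> omega⟩
  · exact ⟨k + 1 - 2 * m, by omega, by omega, by unfold F; split_ifs <;> omega⟩

/-- label and determination of an edge -/
lemma edge_label {a b m : ℕ} (ha3 : 3 ≤ a) (hm : a + b = 2 * m + 1) (u v : Fin a ⊕ Fin b)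
    (h : pos a b v = pos a b u + 1 ∨ (pos a b u = a + b ∧ pos a b v = b + 1)) :
    fe a b m s(u, v) = E m (pos a b u) := by
  rw [fe_mk]
  rcases h with h | ⟨h, h'⟩
  · rw [h, g_succ]
  · rw [h, h', g, if_neg (by omega), if_neg (by omega), hm]

lemma fe_injOn {a b m : ℕ} (ha3 : 3 ≤ a) (hm : a + b = 2 * m + 1) :
    Set.InjOn (fe a b m) (cyclePathGraph a b).edgeSet := by
  intro e he e' he' h
  obtain ⟨u, v, rfl, h1⟩ := edge_cases ha3 e he
  obtain ⟨u', v', rfl, h2⟩ := edge_cases ha3 e' he'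
  rw [edge_label ha3 hm u v h1, edge_label ha3 hm u' v' h2] at h
  have p1 := pos_mem u
  have p2 := pos_mem u'
  have p3 := pos_mem v
  have p4 := pos_mem v'
  have := E_inj p1.1 (by omega) p2.1 (by omega) h
  have hv : pos a b v = pos a b v' := by omega
  rw [pos_inj this, pos_inj hv]

lemma fe_bij {a b m : ℕ} (ha3 : 3 ≤ a) (hm : a + b = 2 * m + 1) :
    Set.BijOn (fe a b m) (cyclePathGraph a b).edgeSet (Set.Icc 1 (a + b)) := by
  refine ⟨?_, fe_injOn ha3 hm, ?_⟩
  · intro e he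
    obtain ⟨u, v, rfl, h1⟩ := edge_cases ha3 e he
    rw [edge_label ha3 hm u v h1]
    have p1 := pos_mem u
    have := E_mem (m := m) p1.1 (by omega)
    exact ⟨this.1, by omega⟩
  · rintro k ⟨hk, hk'⟩
    obtain ⟨i, h1, h2, h3⟩ := E_surj (m := m) hk (by omega)
    obtain ⟨u, hu⟩ := pos_surj (a := a) (b := b) i h1 (by omega)
    by_cases hi : i = a + b
    · obtain ⟨v, hv⟩ := pos_surj (a := a) (b := b) (b + 1) (by omega) (by omega)
      refine ⟨s(u, v), ?_, ?_⟩
      · rw [SimpleGraph.mem_edgeSet, adj_iff ha3]; omega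
      · rw [edge_label ha3 hm u v (by omega), hu, h3]
    · obtain ⟨v, hv⟩ := pos_surj (a := a) (b := b) (i + 1) (by omega) (by omega)
      refine ⟨s(u, v), ?_, ?_⟩
      · rw [SimpleGraph.mem_edgeSet, adj_iff ha3]; omega
      · rw [edge_label ha3 hm u v (by omega), hu, h3]

lemma card_edges {a b m : ℕ} (ha3 : 3 ≤ a) (hm : a + b = 2 * m + 1) :
    (cyclePathGraph a b).edgeFinset.card = a + b := by
  have h := fe_bij ha3 hm
  have h2 : (cyclePathGraph a b).edgeFinset.image (fe a b m) = Finset.Icc 1 (a + b) := by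
    apply Finset.coe_injective
    rw [Finset.coe_image, SimpleGraph.coe_edgeFinset, h.image_eq, Finset.coe_Icc]
  have h3 := Finset.card_image_of_injOn (s := (cyclePathGraph a b).edgeFinset) (f := fe a b m)
    (by rw [SimpleGraph.coe_edgeFinset]; exact h.injOn)
  rw [← h3, h2]; simp

lemma total {a b m : ℕ} (ha3 : 3 ≤ a) (hm : a + b = 2 * m + 1) :
    IsTotalLabeling (cyclePathGraph a b) (fun u => F m (pos a b u)) (fe a b m) := by
  unfold IsTotalLabeling
  rw [card_edges ha3 hm, Fintype.card_sum, Fintype.card_fin, Fintype.card_fin]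
  have hb := fe_bij ha3 hm
  have hF : ∀ u : Fin a ⊕ Fin b, 2 * m + 2 ≤ F m (pos a b u) ∧ F m (pos a b u) ≤ 4 * m + 2 :=
    fun u => F_mem (pos_mem u).1 (by have := (pos_mem u).2; omega)
  have hE : ∀ e : (cyclePathGraph a b).edgeSet, 1 ≤ fe a b m e ∧ fe a b m e ≤ a + b :=
    fun e => hb.mapsTo e.2
  refine ⟨?_, ?_, ?_⟩
  · rintro (u | e) -
    · have := hF u
      simp only [Sum.elim_inl, Set.mem_Icc]; omega
    · have := hE e
      simp only [Sum.elim_inr, Set.mem_Icc]; omega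
  · rintro (u | e) - (u' | e') - h <;> simp only [Sum.elim_inl, Sum.elim_inr] at h
    · have p1 := pos_mem u
      have p2 := pos_mem u'
      rw [pos_inj (F_inj p1.1 (by omega) p2.1 (by omega) h)]
    · have := hF u
      have := hE e'
      omega
    · have := hF u'
      have := hE e
      omega
    · rw [Subtype.ext (hb.injOn e.2 e'.2 h)]
  · rintro k ⟨hk, hk'⟩
    by_cases h : k ≤ a + b
    · obtain ⟨e, he, hek⟩ := hb.surjOn ⟨hk, h⟩
      exact ⟨Sum.inr ⟨e, he⟩, trivial, hek⟩
    · obtain ⟨i, h1, h2, h3⟩ := F_surj (m := m) (k := k) (by omega) (by omega)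
      obtain ⟨u, hu⟩ := pos_surj (a := a) (b := b) i h1 (by omega)
      exact ⟨Sum.inl u, trivial, by simp [hu, h3]⟩

/-- the resulting weight at each trail position -/
def W (b m i : ℕ) : ℕ :=
  if i = 1 ∨ i = b + 1 then 6 * m + 3 else if i % 2 = 0 then 5 * m + 4 else 5 * m + 2

lemma weight {a b m : ℕ} (ha3 : 3 ≤ a) (hm : a + b = 2 * m + 1) (hb : b % 2 = 0) (hb2 : 2 ≤ b)
    (u : Fin a ⊕ Fin b) :
    latWeight (cyclePathGraph a b) (fun u => F m (pos a b u)) (fe a b m) u = W b m (pos a b u) := by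
  have pu := pos_mem u
  have hnb : ∀ v, v ∈ (cyclePathGraph a b).neighborFinset u ↔ _ := fun v =>
    ((cyclePathGraph a b).mem_neighborFinset u v).trans (adj_iff ha3 u v)
  have key : ∀ v k, pos a b v = k → ∀ w, w = v ↔ pos a b w = k := by
    intro v k h w
    exact ⟨fun e => e ▸ h, fun e => pos_inj (e.trans h.symm)⟩
  unfold latWeight
  simp only [fe_mk]
  by_cases h1 : pos a b u = 1
  · obtain ⟨v, hv⟩ := pos_surj (a := a) (b := b) 2 (by omega) (by omega)
    have : (cyclePathGraph a b).neighborFinset u = {v} := by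
      ext w
      have := pos_mem w
      rw [hnb, Finset.mem_singleton, key v _ hv]; omega
    rw [this, Finset.sum_singleton, h1, hv, g_succ m 1]
    simp [F, E, W]; omega
  obtain ⟨i, hi⟩ : ∃ i, pos a b u = i + 1 := ⟨pos a b u - 1, by omega⟩
  obtain ⟨v, hv⟩ := pos_surj (a := a) (b := b) i (by omega) (by omega)
  by_cases h2 : pos a b u = a + b
  · obtain ⟨x, hx⟩ := pos_surj (a := a) (b := b) (b + 1) (by omega) (by omega)
    have hvx : v ≠ x := by rintro rfl; omega
    have : (cyclePathGraph a b).neighborFinset u = {v, x} := by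
      ext w
      have := pos_mem w
      rw [hnb, Finset.mem_insert, Finset.mem_singleton, key v _ hv, key x _ hx]; omega
    rw [this, Finset.sum_pair hvx, hv, hx, hi, g_succ']
    have : g m (i + 1) (b + 1) = E m (2 * m + 1) := by
      rw [g, if_neg (by omega), if_neg (by omega)]
    rw [this]
    unfold F E W
    split_ifs <;> omega
  obtain ⟨x, hx⟩ := pos_surj (a := a) (b := b) (i + 1 + 1) (by omega) (by omega)
  have hvx : v ≠ x := by rintro rfl; omega
  by_cases h3 : pos a b u = b + 1
  · obtain ⟨y, hy⟩ := pos_surj (a := a) (b := b) (a + b) (by omega) (by omega)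
    have hvy : v ≠ y := by rintro rfl; omega
    have hxy : x ≠ y := by rintro rfl; omega
    have : (cyclePathGraph a b).neighborFinset u = {v, x, y} := by
      ext w
      have := pos_mem w
      rw [hnb, Finset.mem_insert, Finset.mem_insert, Finset.mem_singleton, key v _ hv,
        key x _ hx, key y _ hy]
      omega
    rw [this, Finset.sum_insert (by simp [hvx, hvy]), Finset.sum_pair hxy, hv, hx, hy, hi,
      g_succ', g_succ]
    have : g m (i + 1) (a + b) = E m (2 * m + 1) := by
      rw [g, if_neg (by omega), if_neg (by omega)]
    rw [this]
    unfold F E W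
    split_ifs <;> omega
  · have : (cyclePathGraph a b).neighborFinset u = {v, x} := by
      ext w
      have := pos_mem w
      rw [hnb, Finset.mem_insert, Finset.mem_singleton, key v _ hv, key x _ hx]; omega
    rw [this, Finset.sum_pair hvx, hv, hx, hi, g_succ', g_succ]
    unfold F E W
    split_ifs <;> omega

lemma lower {a b : ℕ} (ha : a % 2 = 1) (ha3 : 3 ≤ a) (w : Fin a ⊕ Fin b → ℕ)
    (hw : ∀ ⦃u v⦄, (cyclePathGraph a b).Adj u v → w u ≠ w v) :
    3 ≤ (Finset.univ.image w).card := by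
  by_contra hc
  have h3 : ∀ x y z, w x ≠ w y → w y ≠ w z → w z = w x := by
    intro x y z h1 h2
    by_contra h4
    apply hc
    have : ({w x, w y, w z} : Finset ℕ) ⊆ Finset.univ.image w := by
      intro t ht
      simp only [Finset.mem_insert, Finset.mem_singleton] at ht
      rcases ht with rfl | rfl | rfl <;> exact Finset.mem_image_of_mem _ (Finset.mem_univ _)
    have h5 := Finset.card_le_card this
    rwa [Finset.card_eq_three.2 ⟨w x, w y, w z, h1, fun h => h4 h.symm, h2, rfl⟩] at h5
  have ind : ∀ k (hk : 2 * k < a), w (Sum.inl ⟨2 * k, hk⟩) = w (Sum.inl ⟨0, by omega⟩) := by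
    intro k
    induction k with
    | zero => intro hk; rfl
    | succ k ih =>
      intro hk
      rw [← ih (by omega)]
      apply h3 _ (Sum.inl ⟨2 * k + 1, by omega⟩) <;> apply hw <;> rw [adj_iff ha3] <;>
        simp only [pos] <;> omega
  refine hw (u := Sum.inl ⟨2 * (a / 2), by omega⟩) (v := Sum.inl ⟨0, by omega⟩) ?_
    (ind (a / 2) (by omega))
  rw [adj_iff ha3]
  right; right; right
  simp only [pos]
  exact ⟨trivial, by omega⟩

end CPaux

/-- For every odd `a ≥ 3` and even `b ≥ 2`, the unicyclic graph obtained as the one point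
union of the cycle `C_a` and the path `P_b`, which has order and size `a + b`, has local
antimagic total chromatic number `3`. -/
theorem chiLat_cyclePath (a b : ℕ) (ha : Odd a) (ha3 : 3 ≤ a) (hb : Even b) (hb2 : 2 ≤ b) :
    Fintype.card (Fin a ⊕ Fin b) = a + b ∧
    (cyclePathGraph a b).edgeFinset.card = a + b ∧
    chiLat (cyclePathGraph a b) = 3 := by
  obtain ⟨m, hm⟩ : ∃ m, a + b = 2 * m + 1 := ha.add_even hb
  have ha' : a % 2 = 1 := Nat.odd_iff.1 ha
  have hb' : b % 2 = 0 := Nat.even_iff.1 hb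
  refine ⟨by simp, CPaux.card_edges ha3 hm, ?_⟩
  have hwt := CPaux.weight ha3 hm hb' hb2
  have hlat : IsLocalAntimagicTotal (cyclePathGraph a b)
      (fun u => CPaux.F m (CPaux.pos a b u)) (CPaux.fe a b m) := by
    refine ⟨CPaux.total ha3 hm, ?_⟩
    intro u v h
    rw [hwt, hwt]
    rw [CPaux.adj_iff ha3] at h
    have := CPaux.pos_mem u
    have := CPaux.pos_mem v
    unfold CPaux.W
    split_ifs <;> omega
  apply le_antisymm
  · have hle : chiLat (cyclePathGraph a b) ≤ (Finset.univ.image (latWeight (cyclePathGraph a b)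
        (fun u => CPaux.F m (CPaux.pos a b u)) (CPaux.fe a b m))).card :=
      Nat.sInf_le ⟨_, _, hlat, rfl⟩
    refine hle.trans ?_
    refine (Finset.card_le_card (t := {6 * m + 3, 5 * m + 4, 5 * m + 2}) ?_).trans
      Finset.card_le_three
    intro t ht
    obtain ⟨u, -, rfl⟩ := Finset.mem_image.1 ht
    rw [hwt]
    unfold CPaux.W
    split_ifs <;> simp
  · refine le_csInf ⟨_, _, _, hlat, rfl⟩ ?_
    rintro c ⟨fv, fe, h, rfl⟩
    exact CPaux.lower ha' ha3 _ h.2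
end

section
/- For every odd integer a ≥ 3 and even integer b ≥ 4, the bicyclic graph H obtained as the one point union of the cycles C_a and C_b (identifying one vertex of C_a with one vertex of C_b), satisfies χ_lat(H) = 3. In particular, there exist infinitely many bicyclic tripartite graphs with local antimagic total chromatic number 3. -/
open Finset

variable {V : Type*} [Fintype V] [DecidableEq V]

/-- Adjacency for the one point union of the cycles `C_a` (on `Sum.inl i`, `i : Fin a`) and
`C_b` : the second cycle consists of the vertex `Sum.inl 0` together with the `b - 1` vertices
`Sum.inr j`, `j : Fin (b-1)`. The resulting graph has order `a + b - 1` and size `a + b`. -/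
def twoCyclesR (a b : ℕ) : Fin a ⊕ Fin (b - 1) → Fin a ⊕ Fin (b - 1) → Bool
  | Sum.inl i, Sum.inl i' => decide ((i' : ℕ) = ((i : ℕ) + 1) % a)
  | Sum.inl i, Sum.inr j => decide ((i : ℕ) = 0 ∧ ((j : ℕ) = 0 ∨ (j : ℕ) = b - 2))
  | Sum.inr j, Sum.inr j' => decide ((j' : ℕ) = (j : ℕ) + 1)
  | _, _ => false

/-- The one point union of the cycles `C_a` and `C_b` at the vertex `Sum.inl 0`. -/
abbrev twoCyclesGraph (a b : ℕ) : SimpleGraph (Fin a ⊕ Fin (b - 1)) :=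
  SimpleGraph.fromRel (fun x y => twoCyclesR a b x y = true)

namespace TwoCyc

lemma mod_succ (a i : ℕ) (hi : i < a) : (i + 1) % a = if i + 1 = a then 0 else i + 1 := by
  split_ifs with h
  · rw [h, Nat.mod_self]
  · exact Nat.mod_eq_of_lt (by omega)

lemma adj_ll {a b : ℕ} (ha3 : 3 ≤ a) (i i' : Fin a) :
    (twoCyclesGraph a b).Adj (Sum.inl i) (Sum.inl i') ↔
      ((i' : ℕ) = i + 1 ∨ (i : ℕ) = i' + 1 ∨ ((i : ℕ) = 0 ∧ (i' : ℕ) = a - 1) ∨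
        ((i' : ℕ) = 0 ∧ (i : ℕ) = a - 1)) := by
  have h1 := i.2
  have h2 := i'.2
  simp only [twoCyclesGraph, SimpleGraph.fromRel_adj, twoCyclesR, decide_eq_true_eq, ne_eq,
    Sum.inl.injEq, Fin.ext_iff, mod_succ a i h1, mod_succ a i' h2]
  split_ifs <;> omega

lemma adj_lr {a b : ℕ} (i : Fin a) (j : Fin (b - 1)) :
    (twoCyclesGraph a b).Adj (Sum.inl i) (Sum.inr j) ↔
      ((i : ℕ) = 0 ∧ ((j : ℕ) = 0 ∨ (j : ℕ) = b - 2)) := by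
  simp [twoCyclesGraph, SimpleGraph.fromRel_adj, twoCyclesR]

lemma adj_rl {a b : ℕ} (i : Fin a) (j : Fin (b - 1)) :
    (twoCyclesGraph a b).Adj (Sum.inr j) (Sum.inl i) ↔
      ((i : ℕ) = 0 ∧ ((j : ℕ) = 0 ∨ (j : ℕ) = b - 2)) := by
  rw [SimpleGraph.adj_comm, adj_lr]

lemma adj_rr {a b : ℕ} (j j' : Fin (b - 1)) :
    (twoCyclesGraph a b).Adj (Sum.inr j) (Sum.inr j') ↔
      ((j' : ℕ) = j + 1 ∨ (j : ℕ) = j' + 1) := by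
  simp only [twoCyclesGraph, SimpleGraph.fromRel_adj, twoCyclesR, decide_eq_true_eq, ne_eq,
    Sum.inr.injEq, Fin.ext_iff]
  omega

/-- Position of an edge in the Eulerian closed trail. -/
def idx (a b : ℕ) : Fin a ⊕ Fin (b - 1) → Fin a ⊕ Fin (b - 1) → ℕ
  | Sum.inl i, Sum.inl i' =>
      if ((i : ℕ) = 0 ∧ (i' : ℕ) = a - 1) ∨ ((i' : ℕ) = 0 ∧ (i : ℕ) = a - 1) then a
      else max (i : ℕ) i'
  | Sum.inl _, Sum.inr j => if (j : ℕ) = 0 then a + 1 else a + b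
  | Sum.inr j, Sum.inl _ => if (j : ℕ) = 0 then a + 1 else a + b
  | Sum.inr j, Sum.inr j' => a + 1 + max (j : ℕ) j'

lemma idx_comm (a b : ℕ) (u v) : idx a b u v = idx a b v u := by
  rcases u with i | j <;> rcases v with i' | j' <;> simp only [idx]
  · rw [max_comm]; congr 1; rw [or_comm]
  · rw [max_comm]

/-- Position on unordered pairs. -/
def eidx (a b : ℕ) : Sym2 (Fin a ⊕ Fin (b - 1)) → ℕ :=
  Sym2.lift ⟨idx a b, idx_comm a b⟩

lemma eidx_mk (a b : ℕ) (u v) : eidx a b s(u, v) = idx a b u v := rfl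

/-- Edge label from position. -/
def lab (n k : ℕ) : ℕ := if k % 2 = 1 then (k + 1) / 2 else (n + 1) / 2 + k / 2

/-- Position of a vertex. -/
def pos (a b : ℕ) : Fin a ⊕ Fin (b - 1) → ℕ
  | Sum.inl i => if (i : ℕ) = 0 then a else i
  | Sum.inr j => a + 1 + j

/-- Vertex label from position. -/
def vlab (n j : ℕ) : ℕ := if j % 2 = 1 then 2 * n - 1 - j else 2 * n + 1 - j

lemma pos_inj {a b : ℕ} (u v) (h : pos a b u = pos a b v) : u = v := by
  rcases u with i | j <;> rcases v with i' | j' <;> simp only [pos] at h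
  · have h1 := i.2
    have h2 := i'.2
    congr 1; ext; split_ifs at h <;> omega
  · have h1 := i.2
    split_ifs at h <;> omega
  · have h1 := i'.2
    split_ifs at h <;> omega
  · congr 1; ext; omega

lemma pos_mem {a b : ℕ} (ha3 : 3 ≤ a) (hb4 : 4 ≤ b) (u) :
    1 ≤ pos a b u ∧ pos a b u ≤ a + b - 1 := by
  rcases u with i | j <;> simp only [pos]
  · have h1 := i.2
    split_ifs <;> omega
  · have h1 := j.2
    omega

lemma idx_mem {a b : ℕ} (ha3 : 3 ≤ a) (hb4 : 4 ≤ b) (u v) (h : (twoCyclesGraph a b).Adj u v) :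
    1 ≤ idx a b u v ∧ idx a b u v ≤ a + b := by
  rcases u with i | j <;> rcases v with i' | j' <;>
    simp only [adj_ll ha3, adj_lr, adj_rl, adj_rr, idx] at h ⊢
  · have h1 := i.2
    have h2 := i'.2
    split_ifs <;> omega
  · split_ifs <;> omega
  · split_ifs <;> omega
  · have h1 := j.2
    have h2 := j'.2
    omega

lemma idx_inj {a b : ℕ} (ha3 : 3 ≤ a) (hb4 : 4 ≤ b) (u v u' v')
    (h : (twoCyclesGraph a b).Adj u v) (h' : (twoCyclesGraph a b).Adj u' v')
    (he : idx a b u v = idx a b u' v') : s(u, v) = s(u', v') := by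
  rcases u with ⟨i, hi⟩ | ⟨i, hi⟩ <;> rcases v with ⟨j, hj⟩ | ⟨j, hj⟩ <;>
  rcases u' with ⟨i', hi'⟩ | ⟨i', hi'⟩ <;> rcases v' with ⟨j', hj'⟩ | ⟨j', hj'⟩ <;>
    simp only [adj_ll ha3, adj_lr, adj_rl, adj_rr, idx] at h h' he <;>
    simp only [Sym2.eq_iff, Sum.inl.injEq, Sum.inr.injEq, Fin.mk.injEq, reduceCtorEq,
      and_false, false_and, or_false, false_or] <;>
    (try split_ifs at he) <;> omega

lemma idx_surj {a b : ℕ} (ha3 : 3 ≤ a) (hb4 : 4 ≤ b) (k : ℕ) (h1 : 1 ≤ k) (h2 : k ≤ a + b) :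
    ∃ u v, (twoCyclesGraph a b).Adj u v ∧ idx a b u v = k := by
  by_cases c1 : k < a
  · refine ⟨Sum.inl ⟨k - 1, by omega⟩, Sum.inl ⟨k, c1⟩, ?_, ?_⟩
    · rw [adj_ll ha3]; simp only; omega
    · simp only [idx]; split_ifs <;> omega
  by_cases c2 : k = a
  · refine ⟨Sum.inl ⟨0, by omega⟩, Sum.inl ⟨a - 1, by omega⟩, ?_, ?_⟩
    · rw [adj_ll ha3]; simp
    · simp [idx, c2]
  by_cases c3 : k = a + 1
  · refine ⟨Sum.inl ⟨0, by omega⟩, Sum.inr ⟨0, by omega⟩, ?_, ?_⟩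
    · rw [adj_lr]; simp
    · simp [idx, c3]
  by_cases c4 : k = a + b
  · refine ⟨Sum.inl ⟨0, by omega⟩, Sum.inr ⟨b - 2, by omega⟩, ?_, ?_⟩
    · rw [adj_lr]; simp
    · simp only [idx]; split_ifs <;> omega
  · refine ⟨Sum.inr ⟨k - a - 2, by omega⟩, Sum.inr ⟨k - a - 1, by omega⟩, ?_, ?_⟩
    · rw [adj_rr]; simp only; omega
    · simp only [idx]; omega

lemma card_edges {a b : ℕ} (ha3 : 3 ≤ a) (hb4 : 4 ≤ b) :
    (twoCyclesGraph a b).edgeFinset.card = a + b := by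
  have : (twoCyclesGraph a b).edgeFinset.card = (Finset.Icc 1 (a + b)).card := by
    refine Finset.card_bij (fun e _ => eidx a b e) ?_ ?_ ?_
    · intro e he
      induction e using Sym2.ind with
      | _ u v =>
        rw [SimpleGraph.mem_edgeFinset, SimpleGraph.mem_edgeSet] at he
        rw [Finset.mem_Icc, eidx_mk]
        exact idx_mem ha3 hb4 u v he
    · intro e he e' he' hh
      induction e using Sym2.ind with
      | _ u v =>
        induction e' using Sym2.ind with
        | _ u' v' =>
          rw [SimpleGraph.mem_edgeFinset, SimpleGraph.mem_edgeSet] at he he'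
          exact idx_inj ha3 hb4 u v u' v' he he' hh
    · intro k hk
      rw [Finset.mem_Icc] at hk
      obtain ⟨u, v, huv, hi⟩ := idx_surj ha3 hb4 k hk.1 hk.2
      exact ⟨s(u, v), by rwa [SimpleGraph.mem_edgeFinset, SimpleGraph.mem_edgeSet], hi⟩
  simpa using this

lemma lab_mem {n k : ℕ} (hn : n % 2 = 1) (h1 : 1 ≤ k) (h2 : k ≤ n) :
    1 ≤ lab n k ∧ lab n k ≤ n := by
  unfold lab; split_ifs <;> omega

lemma lab_inj {n k l : ℕ} (hn : n % 2 = 1) (h1 : 1 ≤ k) (h2 : k ≤ n) (h3 : 1 ≤ l) (h4 : l ≤ n)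
    (h : lab n k = lab n l) : k = l := by
  unfold lab at h; split_ifs at h <;> omega

lemma vlab_mem {n k : ℕ} (hn : n % 2 = 1) (h1 : 1 ≤ k) (h2 : k ≤ n - 1) :
    n + 1 ≤ vlab n k ∧ vlab n k ≤ 2 * n - 1 := by
  unfold vlab; split_ifs <;> omega

lemma vlab_inj {n k l : ℕ} (h2 : k ≤ n - 1) (h4 : l ≤ n - 1)
    (h : vlab n k = vlab n l) : k = l := by
  unfold vlab at h; split_ifs at h <;> omega

/-- vertex labelling -/
def fv (a b : ℕ) (u : Fin a ⊕ Fin (b - 1)) : ℕ := vlab (a + b) (pos a b u)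
/-- edge labelling -/
def fe (a b : ℕ) (e : Sym2 (Fin a ⊕ Fin (b - 1))) : ℕ := lab (a + b) (eidx a b e)

lemma card_verts {a b : ℕ} (hb4 : 4 ≤ b) :
    Fintype.card (Fin a ⊕ Fin (b - 1)) = a + b - 1 := by
  simp; omega

lemma total {a b : ℕ} (hn : (a + b) % 2 = 1) (ha3 : 3 ≤ a) (hb4 : 4 ≤ b) :
    IsTotalLabeling (twoCyclesGraph a b) (fv a b) (fe a b) := by
  unfold IsTotalLabeling
  set F := Sum.elim (fv a b) (fun e : (twoCyclesGraph a b).edgeSet => fe a b (e : Sym2 _)) with hF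
  have hv : ∀ u, a + b + 1 ≤ fv a b u ∧ fv a b u ≤ 2 * (a + b) - 1 := fun u =>
    vlab_mem hn (pos_mem ha3 hb4 u).1 (pos_mem ha3 hb4 u).2
  have hi : ∀ e : (twoCyclesGraph a b).edgeSet,
      1 ≤ eidx a b (e : Sym2 _) ∧ eidx a b (e : Sym2 _) ≤ a + b := by
    rintro ⟨e, he⟩
    induction e using Sym2.ind with
    | _ u v => exact idx_mem ha3 hb4 u v he
  have he : ∀ e : (twoCyclesGraph a b).edgeSet, 1 ≤ fe a b (e : Sym2 _) ∧
      fe a b (e : Sym2 _) ≤ a + b := fun e => lab_mem hn (hi e).1 (hi e).2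
  have hinj : Function.Injective F := by
    rintro (u | e) (v | e') h <;> simp only [hF, Sum.elim_inl, Sum.elim_inr] at h
    · rw [pos_inj u v (vlab_inj (pos_mem ha3 hb4 u).2 (pos_mem ha3 hb4 v).2 h)]
    · have := hv u; have := he e'; omega
    · have := hv v; have := he e; omega
    · have h := lab_inj hn (hi e).1 (hi e).2 (hi e').1 (hi e').2 h
      congr 1
      obtain ⟨e, hee⟩ := e
      obtain ⟨e', hee'⟩ := e'
      apply Subtype.ext
      induction e using Sym2.ind with
      | _ u v =>
        induction e' using Sym2.ind with
        | _ u' v' => exact idx_inj ha3 hb4 u v u' v' hee hee' h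
  rw [card_verts hb4, card_edges ha3 hb4]
  have hmaps : ∀ x, F x ∈ Finset.Icc 1 (a + b - 1 + (a + b)) := by
    rintro (u | e) <;> simp only [hF, Sum.elim_inl, Sum.elim_inr, Finset.mem_Icc]
    · have := hv u; omega
    · have := he e; omega
  have himg : Finset.univ.image F = Finset.Icc 1 (a + b - 1 + (a + b)) := by
    apply Finset.eq_of_subset_of_card_le
    · intro y hy
      obtain ⟨x, -, rfl⟩ := Finset.mem_image.1 hy
      exact hmaps x
    · rw [Finset.card_image_of_injective _ hinj, Finset.card_univ, Fintype.card_sum,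
        card_verts hb4, ← SimpleGraph.edgeFinset_card, card_edges ha3 hb4]
      simp
  refine ⟨fun x _ => ?_, hinj.injOn, fun y hy => ?_⟩
  · simpa using hmaps x
  · have : y ∈ Finset.univ.image F := by rw [himg]; simpa using hy
    obtain ⟨x, -, hx⟩ := Finset.mem_image.1 this
    exact ⟨x, trivial, hx⟩

/-- weights -/
def wt (a b : ℕ) (u : Fin a ⊕ Fin (b - 1)) : ℕ :=
  if Sum.elim (fun i : Fin a => (i : ℕ)) (fun _ : Fin (b - 1) => 1) u = 0 then 2 * (a + b) + 2 * ((a + b + 1) / 2) + 1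
  else if pos a b u % 2 = 1 then 2 * (a + b) + (a + b + 1) / 2
  else 2 * (a + b) + (a + b + 1) / 2 + 2

lemma weight_pair {a b : ℕ} (u v w : Fin a ⊕ Fin (b - 1)) (hvw : v ≠ w)
    (h : ∀ x, (twoCyclesGraph a b).Adj u x ↔ x = v ∨ x = w) :
    latWeight (twoCyclesGraph a b) (fv a b) (fe a b) u =
      vlab (a + b) (pos a b u) + (lab (a + b) (idx a b u v) + lab (a + b) (idx a b u w)) := by
  have : (twoCyclesGraph a b).neighborFinset u = {v, w} := by
    ext x; rw [SimpleGraph.mem_neighborFinset, h]; simp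
  rw [latWeight, this, Finset.sum_pair hvw]; rfl

lemma lab_add (n k : ℕ) (hn : n % 2 = 1) : lab n k + lab n (k + 1) = (n + 1) / 2 + k + 1 := by
  unfold lab; split_ifs <;> omega

lemma sum_eq (n k : ℕ) (hn : n % 2 = 1) (h2 : k ≤ n - 1) :
    vlab n k + (lab n k + lab n (k + 1)) =
      if k % 2 = 1 then 2 * n + (n + 1) / 2 else 2 * n + (n + 1) / 2 + 2 := by
  rw [lab_add n k hn]; unfold vlab; split_ifs <;> omega

lemma weight_eq {a b : ℕ} (ha : a % 2 = 1) (hb : b % 2 = 0) (ha3 : 3 ≤ a) (hb4 : 4 ≤ b) (u) :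
    latWeight (twoCyclesGraph a b) (fv a b) (fe a b) u = wt a b u := by
  have hn : (a + b) % 2 = 1 := by omega
  rcases u with ⟨i, hi⟩ | ⟨j, hj⟩
  · by_cases h0 : i = 0
    · subst h0
      have hN : (twoCyclesGraph a b).neighborFinset (Sum.inl ⟨0, hi⟩) =
          {Sum.inl ⟨1, by omega⟩, Sum.inl ⟨a - 1, by omega⟩, Sum.inr ⟨0, by omega⟩,
            Sum.inr ⟨b - 2, by omega⟩} := by
        ext x
        rw [SimpleGraph.mem_neighborFinset]
        rcases x with ⟨k, hk⟩ | ⟨k, hk⟩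
        · rw [adj_ll ha3]; simp; omega
        · rw [adj_lr]; simp
      rw [latWeight, hN, Finset.sum_insert (by simp; omega), Finset.sum_insert (by simp),
        Finset.sum_pair (by simp; omega)]
      have e1 : idx a b (Sum.inl ⟨0, hi⟩) (Sum.inl ⟨1, by omega⟩) = 1 := by
        simp only [idx]; split_ifs <;> omega
      have e2 : idx a b (Sum.inl ⟨0, hi⟩) (Sum.inl ⟨a - 1, by omega⟩) = a := by simp [idx]
      have e3 : idx a b (Sum.inl ⟨0, hi⟩) (Sum.inr ⟨0, by omega⟩) = a + 1 := by simp [idx]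
      have e4 : idx a b (Sum.inl ⟨0, hi⟩) (Sum.inr ⟨b - 2, by omega⟩) = a + b := by
        simp only [idx]; split_ifs <;> omega
      have hp : pos a b (Sum.inl ⟨0, hi⟩) = a := by simp [pos]
      simp only [fe, fv, eidx_mk, e1, e2, e3, e4, hp]
      have h := sum_eq (a + b) a hn (by omega)
      rw [if_pos ha] at h
      have l1 : lab (a + b) 1 = 1 := by simp [lab]
      have l2 : lab (a + b) (a + b) = (a + b + 1) / 2 := by simp [lab, hn]
      simp only [wt, Sum.elim_inl, if_true]
      omega
    · have hp : pos a b (Sum.inl ⟨i, hi⟩) = i := by simp [pos, h0]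
      have hw : wt a b (Sum.inl ⟨i, hi⟩) =
          vlab (a + b) i + (lab (a + b) i + lab (a + b) (i + 1)) := by
        rw [sum_eq (a + b) i hn (by omega)]
        simp only [wt, Sum.elim_inl, if_neg h0, hp]
      rw [hw]
      by_cases hl : i = a - 1
      · rw [weight_pair _ (Sum.inl ⟨i - 1, by omega⟩) (Sum.inl ⟨0, by omega⟩)
          (by simp; omega) ?_, hp]
        · congr 3
          · simp only [idx]; split_ifs <;> omega
          · simp only [idx, true_and]; split_ifs <;> omega
        · rintro (⟨k, hk⟩ | ⟨k, hk⟩)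
          · rw [adj_ll ha3]; simp; omega
          · rw [adj_lr]; simp; omega
      · rw [weight_pair _ (Sum.inl ⟨i - 1, by omega⟩) (Sum.inl ⟨i + 1, by omega⟩)
          (by simp) ?_, hp]
        · congr 3
          · simp only [idx]; split_ifs <;> omega
          · simp only [idx]; split_ifs <;> omega
        · rintro (⟨k, hk⟩ | ⟨k, hk⟩)
          · rw [adj_ll ha3]; simp; omega
          · rw [adj_lr]; simp; omega
  · have hp : pos a b (Sum.inr ⟨j, hj⟩) = a + 1 + j := by simp [pos]
    have hw : wt a b (Sum.inr ⟨j, hj⟩) =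
        vlab (a + b) (a + 1 + j) + (lab (a + b) (a + 1 + j) + lab (a + b) (a + 1 + j + 1)) := by
      rw [sum_eq (a + b) (a + 1 + j) hn (by omega)]
      simp only [wt, Sum.elim_inr, if_neg one_ne_zero, hp]
    rw [hw]
    by_cases h0 : j = 0
    · rw [weight_pair _ (Sum.inl ⟨0, by omega⟩) (Sum.inr ⟨j + 1, by omega⟩) (by simp) ?_, hp]
      · congr 3
        · simp only [idx]; split_ifs; omega
        · simp only [idx]; omega
      · rintro (⟨k, hk⟩ | ⟨k, hk⟩)
        · rw [adj_rl]; simp; omega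
        · rw [adj_rr]; simp; omega
    by_cases hl : j = b - 2
    · rw [weight_pair _ (Sum.inr ⟨j - 1, by omega⟩) (Sum.inl ⟨0, by omega⟩) (by simp) ?_, hp]
      · congr 3
        · simp only [idx]; omega
        · simp only [idx]; split_ifs; omega
      · rintro (⟨k, hk⟩ | ⟨k, hk⟩)
        · rw [adj_rl]; simp; omega
        · rw [adj_rr]; simp; omega
    · rw [weight_pair _ (Sum.inr ⟨j - 1, by omega⟩) (Sum.inr ⟨j + 1, by omega⟩)
        (by simp) ?_, hp]
      · congr 3
        · simp only [idx]; omega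
        · simp only [idx]; omega
      · rintro (⟨k, hk⟩ | ⟨k, hk⟩)
        · rw [adj_rl]; simp; omega
        · rw [adj_rr]; simp; omega

lemma wt_l {a b : ℕ} (i : Fin a) : wt a b (Sum.inl i) =
    if (i : ℕ) = 0 then 2 * (a + b) + 2 * ((a + b + 1) / 2) + 1
    else if (i : ℕ) % 2 = 1 then 2 * (a + b) + (a + b + 1) / 2
    else 2 * (a + b) + (a + b + 1) / 2 + 2 := by
  by_cases h : (i : ℕ) = 0 <;> simp [wt, pos, h]

lemma wt_r {a b : ℕ} (j : Fin (b - 1)) : wt a b (Sum.inr j) =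
    if (a + 1 + (j : ℕ)) % 2 = 1 then 2 * (a + b) + (a + b + 1) / 2
    else 2 * (a + b) + (a + b + 1) / 2 + 2 := by
  unfold wt
  rw [if_neg (by simp)]
  rfl

lemma wt_ne {a b : ℕ} (ha : a % 2 = 1) (ha3 : 3 ≤ a) (hb4 : 4 ≤ b) (u v)
    (h : (twoCyclesGraph a b).Adj u v) : wt a b u ≠ wt a b v := by
  intro he
  rcases u with ⟨i, hi⟩ | ⟨i, hi⟩ <;> rcases v with ⟨j, hj⟩ | ⟨j, hj⟩ <;>
    simp only [adj_ll ha3, adj_lr, adj_rl, adj_rr] at h <;>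
    simp only [wt_l, wt_r] at he <;> split_ifs at he <;> omega

lemma three_le {a b : ℕ} (ha : a % 2 = 1) (ha3 : 3 ≤ a)
    (w : Fin a ⊕ Fin (b - 1) → ℕ)
    (h : ∀ ⦃u v⦄, (twoCyclesGraph a b).Adj u v → w u ≠ w v) :
    3 ≤ (Finset.univ.image w).card := by
  by_contra hc
  have key : ∀ x y z, w x ≠ w y → w y ≠ w z → w x = w z := by
    intro x y z h1 h2
    by_contra h3
    apply hc
    exact Finset.two_lt_card.2 ⟨w x, by simp, w y, by simp, w z, by simp, h1, h3, h2⟩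
  have hev : ∀ k, (hk : 2 * k < a) → w (Sum.inl ⟨2 * k, hk⟩) = w (Sum.inl ⟨0, by omega⟩) := by
    intro k
    induction k with
    | zero => intro _; rfl
    | succ k ih =>
      intro hk
      rw [← ih (by omega)]
      apply key _ (Sum.inl ⟨2 * k + 1, by omega⟩)
      · apply h; rw [adj_ll ha3]; simp only; omega
      · apply h; rw [adj_ll ha3]; simp
  refine h (?_ : (twoCyclesGraph a b).Adj (Sum.inl ⟨2 * (a / 2), by omega⟩)
    (Sum.inl ⟨0, by omega⟩)) (hev (a / 2) (by omega))
  rw [adj_ll ha3]; simp only [true_and]; omega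

end TwoCyc

/-- For every odd `a ≥ 3` and even `b ≥ 4`, the bicyclic graph obtained as the one point
union of the cycles `C_a` and `C_b`, which has order `a + b - 1` and size `a + b`, has local
antimagic total chromatic number `3`. -/
theorem chiLat_twoCycles (a b : ℕ) (ha : Odd a) (ha3 : 3 ≤ a) (hb : Even b) (hb4 : 4 ≤ b) :
    Fintype.card (Fin a ⊕ Fin (b - 1)) = a + b - 1 ∧
    (twoCyclesGraph a b).edgeFinset.card = a + b ∧
    chiLat (twoCyclesGraph a b) = 3 := by
  have ha' : a % 2 = 1 := Nat.odd_iff.1 ha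
  have hb' : b % 2 = 0 := Nat.even_iff.1 hb
  refine ⟨TwoCyc.card_verts hb4, TwoCyc.card_edges ha3 hb4, ?_⟩
  have hw : latWeight (twoCyclesGraph a b) (TwoCyc.fv a b) (TwoCyc.fe a b) = TwoCyc.wt a b :=
    funext (TwoCyc.weight_eq ha' hb' ha3 hb4)
  have hL : IsLocalAntimagicTotal (twoCyclesGraph a b) (TwoCyc.fv a b) (TwoCyc.fe a b) := by
    refine ⟨TwoCyc.total (by omega) ha3 hb4, fun u v huv => ?_⟩
    rw [hw]
    exact TwoCyc.wt_ne ha' ha3 hb4 u v huv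
  have hmem : 3 ∈ {c | ∃ fv fe, IsLocalAntimagicTotal (twoCyclesGraph a b) fv fe ∧
      (Finset.univ.image (latWeight (twoCyclesGraph a b) fv fe)).card = c} := by
    refine ⟨_, _, hL, le_antisymm ?_ (TwoCyc.three_le ha' ha3 _ hL.2)⟩
    rw [hw]
    refine le_trans (Finset.card_le_card (t := {2 * (a + b) + 2 * ((a + b + 1) / 2) + 1,
      2 * (a + b) + (a + b + 1) / 2, 2 * (a + b) + (a + b + 1) / 2 + 2}) ?_) Finset.card_le_three
    intro y hy
    obtain ⟨x, -, rfl⟩ := Finset.mem_image.1 hy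
    unfold TwoCyc.wt
    split_ifs <;> simp
  refine le_antisymm (Nat.sInf_le hmem) (le_csInf ⟨3, hmem⟩ ?_)
  rintro c ⟨fv, fe, h, rfl⟩
  exact TwoCyc.three_le ha' ha3 _ h.2
end
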